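/- arXiv:1505.02995 — 4 statements merged into one kernel-verified Lean document; each statement's English description precedes it below -/
import Mathlib

section
/- Let X be a complex Banach space and f ∈ L¹_loc(ℝ₊, X) a Laplace transformable function with abscissa ω_f. Then for all λ, μ ∈ ℂ with Re λ > ω_f, Re μ > ω_f and λ ≠ μ, the double Laplace transform of f⁺(t,s) := f(t+s) exists at (λ,μ) and L₂(f⁺)(λ,μ) = (f̂(λ) − f̂(μ))/(μ − λ). -/
open MeasureTheory Filter Set Topology Complex

noncomputable section

lemma ac_integral {X : Type*} [NormedAddCommGroup X] [NormedSpace ℝ X]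
    {g : ℝ → X} {a b : ℝ} (h : IntervalIntegrable g volume a b) :
    AbsolutelyContinuousOnInterval (fun x => ∫ v in a..x, g v) a b := by
  have h1 := h.norm.absolutelyContinuousOnInterval_intervalIntegral (c := a) (by simp)
  rw [absolutelyContinuousOnInterval_iff] at h1 ⊢
  intro ε hε
  obtain ⟨δ, hδ, H⟩ := h1 ε hε
  refine ⟨δ, hδ, fun E hE hs => lt_of_le_of_lt (Finset.sum_le_sum fun i hi => ?_) (H E hE hs)⟩
  have hm := hE.1 i hi
  have i1 : ∀ x ∈ uIcc a b, IntervalIntegrable g volume a x := fun x hx =>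
    h.mono_set (uIcc_subset_uIcc_left hx)
  rw [dist_eq_norm, dist_eq_norm,
    intervalIntegral.integral_interval_sub_left (i1 _ hm.1) (i1 _ hm.2),
    intervalIntegral.integral_interval_sub_left (i1 _ hm.1).norm (i1 _ hm.2).norm]
  exact intervalIntegral.norm_integral_le_abs_integral_norm

lemma ibp {X : Type*} [NormedAddCommGroup X] [NormedSpace ℂ X] [CompleteSpace X]
    {g P : ℝ → X} {a b : ℝ} (h : IntervalIntegrable g volume a b) (d : ℂ)
    (hP : ∀ x ∈ uIcc a b, P x = P a + ∫ v in a..x, g v) :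
    cexp (d * b) • P b - cexp (d * a) • P a =
      (∫ t in a..b, cexp (d * t) • g t) + d • ∫ t in a..b, cexp (d * t) • P t := by
  have hPac : AbsolutelyContinuousOnInterval (fun x => P a + ∫ v in a..x, g v) a b := by
    refine AbsolutelyContinuousOnInterval.add (f := fun _ => P a) ?_ (ac_integral h)
    exact (contDiff_const.contDiffOn).absolutelyContinuousOnInterval
  have hec : Continuous fun t : ℝ => cexp (d * t) := by fun_prop
  have heac : AbsolutelyContinuousOnInterval (fun t : ℝ => cexp (d * t)) a b := by
    refine ContDiffOn.absolutelyContinuousOnInterval (ContDiff.contDiffOn ?_)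
    exact (contDiff_const.mul Complex.ofRealCLM.contDiff).cexp
  have hQc : IntervalIntegrable (fun t => cexp (d * t) • P t) volume a b := by
    refine ContinuousOn.intervalIntegrable ?_
    exact hec.continuousOn.smul (hPac.continuousOn.congr hP)
  have hg' : IntervalIntegrable (fun t : ℝ => cexp (d * t) • g t) volume a b :=
    h.continuousOn_smul hec.continuousOn
  have hQd : IntervalIntegrable (fun t : ℝ => d • cexp (d * t) • P t) volume a b := hQc.smul d
  have hk : IntervalIntegrable (fun t : ℝ => cexp (d * t) • g t + d • cexp (d * t) • P t)
    volume a b := hg'.add hQd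
  have hH := (heac.smul hPac).sub (ac_integral hk)
  obtain ⟨C, hC⟩ := hH.const_of_ae_hasDerivAt_zero (by
    filter_upwards [h.ae_hasDerivAt_integral, hk.ae_hasDerivAt_integral] with x h1 h2 hx
    have e1 := h1 hx a (by simp)
    have e2 := h2 hx a (by simp)
    have e3 : HasDerivAt (fun t : ℝ => cexp (d * t)) (cexp (d * x) * (d * 1)) x :=
      (((hasDerivAt_id (x : ℂ)).const_mul d).cexp).comp_ofReal
    have := (e3.smul (e1.const_add (P a))).sub e2
    convert! this using 1
    rw [← hP x hx]
    simp only [mul_one, smul_smul, mul_comm]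
    abel)
  have ea := hC a (by simp)
  have eb := hC b (by simp)
  have := eb.trans ea.symm
  simp only [Pi.sub_apply, Pi.smul_apply', intervalIntegral.integral_same, add_zero, sub_zero] at this
  rw [← hP b (by simp), intervalIntegral.integral_add hg' hQd,
    intervalIntegral.integral_smul] at this
  rw [← this]; abel

lemma ii {X : Type*} [NormedAddCommGroup X] [NormedSpace ℂ X]
    {f : ℝ → X} (hfloc : LocallyIntegrableOn f (Set.Ici (0:ℝ))) (l : ℂ) {a b : ℝ}
    (ha : 0 ≤ a) (hb : 0 ≤ b) :
    IntervalIntegrable (fun t : ℝ => cexp (-(l * t)) • f t) volume a b := by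
  have : IntervalIntegrable f volume a b := by
    rw [intervalIntegrable_iff]
    refine (hfloc.integrableOn_compact_subset ?_ isCompact_uIcc).mono_set uIoc_subset_uIcc
    intro x hx
    exact (le_min ha hb).trans hx.1
  exact this.continuousOn_smul (by fun_prop)

lemma cauchy_tail {X : Type*} [NormedAddCommGroup X] 
    {G : ℝ → X} {L : X} (hG : Tendsto G atTop (𝓝 L)) {ε : ℝ} (hε : 0 < ε) :
    ∀ᶠ T in atTop, ∀ r ≥ T, ‖G r - G T‖ < ε := by
  obtain ⟨N, hN⟩ := Metric.cauchySeq_iff.1 hG.cauchySeq ε hε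
  filter_upwards [eventually_ge_atTop N] with T hT r hr
  rw [← dist_eq_norm]
  exact hN r (hT.trans hr) T hT

lemma tailA {X : Type*} [NormedAddCommGroup X] [NormedSpace ℂ X] [CompleteSpace X]
    {f : ℝ → X} (hfloc : LocallyIntegrableOn f (Set.Ici (0:ℝ)))
    {F : ℂ → X} (lam mu : ℂ) 
    (hl : Tendsto (fun T : ℝ => ∫ t in (0:ℝ)..T, cexp (-(lam * t)) • f t) atTop (𝓝 (F lam)))
    (hm : Tendsto (fun T : ℝ => ∫ t in (0:ℝ)..T, cexp (-(mu * t)) • f t) atTop (𝓝 (F mu))) :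
    Tendsto (fun T : ℝ => cexp ((mu - lam) * T) • ∫ t in T..(2*T), cexp (-(mu * t)) • f t)
      atTop (𝓝 0) := by
  rw [Metric.tendsto_nhds]
  intro ε hε
  by_cases hd : (mu - lam).re ≤ 0
  · filter_upwards [cauchy_tail hm hε, eventually_ge_atTop 0] with T hT hT0
    have := hT (2*T) (by linarith)
    rw [intervalIntegral.integral_interval_sub_left (ii hfloc mu le_rfl (by linarith))
      (ii hfloc mu le_rfl hT0)] at this
    rw [dist_zero_right, norm_smul, Complex.norm_exp]
    refine lt_of_le_of_lt (mul_le_of_le_one_left (norm_nonneg _) ?_) this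
    rw [Real.exp_le_one_iff, Complex.re_mul_ofReal]
    exact mul_nonpos_of_nonpos_of_nonneg hd hT0
  push Not at hd
  set d := mu - lam with hdd
  set a := d.re with ha
  set K := 1 + ‖d‖ / a with hK
  have hKp : 0 < K := by positivity
  filter_upwards [cauchy_tail hl (div_pos hε (mul_pos two_pos hKp)), eventually_ge_atTop 0] with T hT hT0
  set η := ε / (2 * K) with hη
  have hηp : 0 < η := by positivity
  have h2 : T ≤ 2 * T := by linarith
  let P : ℝ → X := fun x => ∫ t in T..x, cexp (-(lam * t)) • f t
  have hPb : ∀ r ≥ T, ‖P r‖ ≤ η := fun r hr => by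
    have := hT r hr
    rw [intervalIntegral.integral_interval_sub_left (ii hfloc lam le_rfl (by linarith))
      (ii hfloc lam le_rfl hT0)] at this
    exact this.le
  have key := ibp (P := P) (ii hfloc lam hT0 (show 0 ≤ 2 * T by linarith)) (-d)
    (by intro x hx; simp [P])
  have hPT : P T = 0 := by simp [P]
  have e1 : ∀ t : ℝ, cexp (-d * t) • cexp (-(lam * t)) • f t = cexp (-(mu * t)) • f t := by
    intro t
    rw [smul_smul, ← Complex.exp_add]
    congr 2; rw [hdd]; ring
  simp only [e1, hPT, smul_zero, sub_zero] at key
  have key2 : (∫ t in T..(2*T), cexp (-(mu * t)) • f t) =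
      cexp (-d * (2 * T : ℝ)) • P (2 * T) + d • ∫ t in T..(2*T), cexp (-d * t) • P t := by
    rw [key, neg_smul]; abel
  rw [key2, smul_add, smul_smul, ← Complex.exp_add, smul_comm,
    ← intervalIntegral.integral_smul (cexp (d * T)) (fun t : ℝ => cexp (-d * t) • P t),
    dist_zero_right]
  have b1 : ‖cexp (d * T + -d * (2 * T : ℝ)) • P (2 * T)‖ ≤ η := by
    rw [norm_smul, Complex.norm_exp]
    refine (mul_le_of_le_one_left (norm_nonneg _) ?_).trans (hPb _ h2)
    rw [Real.exp_le_one_iff]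
    have : d * T + -d * (2 * T : ℝ) = d * ((-T : ℝ) : ℂ) := by push_cast; ring
    rw [this, Complex.re_mul_ofReal]
    nlinarith
  have hcr : Continuous fun t : ℝ => Real.exp (a * (T - t)) * η := by fun_prop
  have b2 : ‖∫ t in T..(2*T), cexp (d * T) • cexp (-d * t) • P t‖ ≤ η / a := by
    calc _ ≤ ∫ t in T..(2*T), Real.exp (a * (T - t)) * η := by
          refine intervalIntegral.norm_integral_le_of_norm_le h2 ?_ (hcr.intervalIntegrable _ _)
          refine ae_of_all _ fun t ht => ?_
          rw [smul_smul, ← Complex.exp_add, norm_smul, Complex.norm_exp]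
          have : d * T + -d * t = d * ((T - t : ℝ) : ℂ) := by push_cast; ring
          rw [this, Complex.re_mul_ofReal]
          gcongr
          exact hPb _ ht.1.le
      _ = (-(Real.exp (a * (T - 2 * T)) * η / a)) - (-(Real.exp (a * (T - T)) * η / a)) := by
          refine intervalIntegral.integral_eq_sub_of_hasDerivAt
            (f := fun t => -(Real.exp (a * (T - t)) * η / a)) ?_ (hcr.intervalIntegrable _ _)
          intro x _
          have := ((((((hasDerivAt_id x).const_sub T).const_mul a).exp).mul_const η).div_const a).neg
          convert! this using 1
          field_simp
          simp
      _ ≤ η / a := by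
          have : 0 ≤ Real.exp (a * (T - 2 * T)) * η / a := by positivity
          simp only [sub_self, mul_zero, Real.exp_zero, one_mul]
          linarith
  calc _ ≤ η + ‖d‖ * (η / a) := by
        refine (norm_add_le _ _).trans (add_le_add b1 ?_)
        rw [norm_smul]; gcongr
    _ = η * K := by rw [hK]; ring
    _ = ε / 2 := by rw [hη]; field_simp
    _ < ε := by linarith

/-- If `f ∈ L¹_loc(ℝ₊,X)` is Laplace transformable with abscissa `ω`
and transform `F`, then for `Re λ, Re μ > ω` with `λ ≠ μ` the double Laplace
transform of `f⁺(t,s) = f(t+s)` exists and equals `(F(λ) − F(μ))/(μ − λ)`. -/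
theorem doubleLaplace_fplus
    {X : Type*} [NormedAddCommGroup X] [NormedSpace ℂ X]
    (f : ℝ → X) (hfloc : LocallyIntegrableOn f (Set.Ici (0:ℝ)))
    (ω : ℝ) (F : ℂ → X)
    (hf : ∀ lam : ℂ, ω < lam.re →
      Tendsto (fun T : ℝ => ∫ t in (0:ℝ)..T, Complex.exp (-(lam * t)) • f t)
        atTop (nhds (F lam)))
    (lam mu : ℂ) (hl : ω < lam.re) (hm : ω < mu.re) (hne : lam ≠ mu) :
    Tendsto (fun T : ℝ => ∫ t in (0:ℝ)..T, ∫ s in (0:ℝ)..T,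
        Complex.exp (-(lam * t) - mu * s) • f (t + s))
      atTop (nhds ((mu - lam)⁻¹ • (F lam - F mu))) := by
  by_cases hX : CompleteSpace X
  swap
  · have h0 : ∀ z : ℂ, ω < z.re → F z = 0 := fun z hz => by
      have := hf z hz
      simp only [intervalIntegral.intervalIntegral_eq_integral_uIoc, integral, hX, dite_false,
        smul_zero] at this
      exact tendsto_nhds_unique this tendsto_const_nhds
    rw [h0 _ hl, h0 _ hm]
    simp only [intervalIntegral.intervalIntegral_eq_integral_uIoc, integral, hX, dite_false,
        smul_zero, sub_zero]
    exact tendsto_const_nhds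
  have hd0 : mu - lam ≠ 0 := sub_ne_zero.2 hne.symm
  have A1 := tailA hfloc lam mu (hf _ hl) (hf _ hm)
  have A2 := tailA hfloc mu lam (hf _ hm) (hf _ hl)
  have L := (((A1.sub A2).add (hf _ hl)).sub (hf _ hm)).const_smul (mu - lam)⁻¹
  rw [sub_zero, zero_add] at L
  refine L.congr' ?_
  filter_upwards [eventually_ge_atTop 0] with T hT
  set d := mu - lam with hdd
  have h2 : 0 ≤ 2 * T := by linarith
  let gm : ℝ → X := fun t => cexp (-(mu * t)) • f t
  let gl : ℝ → X := fun t => cexp (-(lam * t)) • f t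
  let P : ℝ → X := fun x => ∫ t in x..(x+T), gm t
  have im : ∀ a b : ℝ, 0 ≤ a → 0 ≤ b → IntervalIntegrable gm volume a b :=
    fun a b ha hb => ii hfloc mu ha hb
  have il : ∀ a b : ℝ, 0 ≤ a → 0 ≤ b → IntervalIntegrable gl volume a b :=
    fun a b ha hb => ii hfloc lam ha hb
  have inner : ∀ t : ℝ, ∫ s in (0:ℝ)..T, cexp (-(lam * t) - mu * s) • f (t + s)
      = cexp (d * t) • P t := by
    intro t
    have : ∀ s : ℝ, cexp (-(lam * t) - mu * s) • f (t + s) = cexp (d * t) • gm (t + s) := by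
      intro s
      simp only [gm, smul_smul, ← Complex.exp_add]
      congr 2; rw [hdd]; push_cast; ring
    simp only [this]
    rw [intervalIntegral.integral_smul, intervalIntegral.integral_comp_add_left, add_zero]
  simp only [inner]
  have ishift : IntervalIntegrable (fun t => gm (T + t)) volume 0 T := by
    have := (im T (2*T) hT h2).comp_add_left T
    simpa [two_mul] using this
  have hP : ∀ x ∈ uIcc 0 T, P x = P 0 + ∫ v in (0:ℝ)..x, (gm (T + v) - gm v) := by
    intro x hx
    rw [uIcc_of_le hT] at hx
    have hx0 := hx.1
    have hxs : IntervalIntegrable (fun t => gm (T + t)) volume 0 x :=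
      ishift.mono_set (uIcc_subset_uIcc_left (by rwa [uIcc_of_le hT]))
    rw [intervalIntegral.integral_sub hxs (im _ _ le_rfl hx0),
      intervalIntegral.integral_comp_add_left, add_zero]
    simp only [P, zero_add]
    rw [add_comm x T, ← intervalIntegral.integral_interval_sub_left
        (im 0 (T + x) le_rfl (by linarith)) (im 0 x le_rfl hx0),
      ← intervalIntegral.integral_add_adjacent_intervals (im 0 T le_rfl hT)
        (im T (T + x) hT (by linarith))]
    abel
  have key := ibp (ishift.sub (im 0 T le_rfl hT)) d hP
  have e1 : ∫ t in (0:ℝ)..T, cexp (d * t) • (gm (T + t) - gm t) =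
      cexp ((lam - mu) * T) • (∫ t in T..(2*T), gl t) - ∫ t in (0:ℝ)..T, gl t := by
    have : ∀ t : ℝ, cexp (d * t) • (gm (T + t) - gm t)
        = cexp ((lam - mu) * T) • gl (T + t) - gl t := by
      intro t
      simp only [gm, gl, smul_sub, smul_smul, ← Complex.exp_add]
      congr 3 <;> rw [hdd] <;> push_cast <;> ring
    simp only [this]
    have lshift : IntervalIntegrable (fun t => gl (T + t)) volume 0 T := by
      have := (il T (2*T) hT h2).comp_add_left T
      simpa [two_mul] using this
    have lsmul : IntervalIntegrable (fun t => cexp ((lam - mu) * T) • gl (T + t)) volume 0 T :=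
      lshift.smul _
    rw [intervalIntegral.integral_sub lsmul (il _ _ le_rfl hT),
      intervalIntegral.integral_smul, intervalIntegral.integral_comp_add_left, add_zero, two_mul]
  rw [e1] at key
  have hPT : P T = ∫ t in T..(2*T), gm t := by simp only [P, two_mul]
  have hP0 : P 0 = ∫ t in (0:ℝ)..T, gm t := by simp only [P, zero_add]
  rw [hPT, hP0] at key
  simp only [ofReal_zero, mul_zero, Complex.exp_zero, one_smul] at key
  rw [inv_smul_eq_iff₀ hd0]
  have k2 := eq_sub_of_add_eq' key.symm
  rw [k2]
  abel
end
end

section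
/- Let X be a complex Banach space and f ∈ L¹_loc(ℝ₊, X) a Laplace transformable function with abscissa ω_f. Then for all λ, μ ∈ ℂ with Re λ > ω_f, Re μ > ω_f and Re(λ+μ) > 0, the double Laplace transform of f⁻(t,s) := f(|t−s|) exists at (λ,μ) and L₂(f⁻)(λ,μ) = (f̂(λ) + f̂(μ))/(λ + μ). -/
open MeasureTheory Filter Set Topology Complex

noncomputable section

lemma dl_integrableOn {X : Type*} [NormedAddCommGroup X] [NormedSpace ℂ X]
    (f : ℝ → X) (hfloc : LocallyIntegrableOn f (Set.Ici (0:ℝ))) (lam : ℂ) (T : ℝ) :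
    IntegrableOn (fun t : ℝ => Complex.exp (-(lam * t)) • (Ioi (0:ℝ)).indicator f t) (Iic T) := by
  have h1 : IntegrableOn (fun t : ℝ => Complex.exp (-(lam * t)) • f t) (Icc 0 T) := by
    refine IntegrableOn.continuousOn_smul ?_ ?_ isCompact_Icc
    · exact hfloc.integrableOn_compact_subset Icc_subset_Ici_self isCompact_Icc
    · fun_prop
  have h2 : (fun t : ℝ => Complex.exp (-(lam * t)) • (Ioi (0:ℝ)).indicator f t)
      = (Ioi (0:ℝ)).indicator (fun t : ℝ => Complex.exp (-(lam * t)) • f t) := by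
    ext t
    by_cases ht : t ∈ Ioi (0:ℝ)
    · simp only [indicator_of_mem ht]
    · simp only [indicator_of_notMem ht, smul_zero]
  rw [h2, IntegrableOn, integrable_indicator_iff measurableSet_Ioi, IntegrableOn,
    Measure.restrict_restrict measurableSet_Ioi]
  exact h1.mono_set (fun x hx => ⟨hx.1.le, hx.2⟩)

/-- Primitive of the (extended by zero) weighted function. -/
def dlG {X : Type*} [NormedAddCommGroup X] [NormedSpace ℂ X] (f : ℝ → X) (lam : ℂ) (r : ℝ) : X :=
  ∫ t in (0:ℝ)..r, Complex.exp (-(lam * t)) • (Ioi (0:ℝ)).indicator f t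

lemma dlG_of_nonpos {X : Type*} [NormedAddCommGroup X] [NormedSpace ℂ X] (f : ℝ → X) (lam : ℂ)
    (r : ℝ) (hr : r ≤ 0) : dlG f lam r = 0 := by
  unfold dlG
  rw [intervalIntegral.integral_of_ge hr, setIntegral_eq_zero_of_forall_eq_zero, neg_zero]
  intro x hx
  rw [indicator_of_notMem, smul_zero]
  exact not_lt.2 hx.2

lemma dlG_of_nonneg {X : Type*} [NormedAddCommGroup X] [NormedSpace ℂ X] (f : ℝ → X) (lam : ℂ)
    (r : ℝ) (hr : 0 ≤ r) : dlG f lam r = ∫ t in (0:ℝ)..r, Complex.exp (-(lam * t)) • f t := by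
  unfold dlG
  rw [intervalIntegral.integral_of_le hr, intervalIntegral.integral_of_le hr]
  refine setIntegral_congr_fun measurableSet_Ioc ?_
  intro x hx
  have : x ∈ Ioi (0:ℝ) := hx.1
  simp only [indicator_of_mem this]

lemma dl_limit {X : Type*} [NormedAddCommGroup X] [NormedSpace ℂ X] [CompleteSpace X]
    (f : ℝ → X) (hfloc : LocallyIntegrableOn f (Set.Ici (0:ℝ))) (lam a : ℂ) (ha : 0 < a.re) (y : X)
    (hf : Tendsto (fun T : ℝ => ∫ t in (0:ℝ)..T, Complex.exp (-(lam * t)) • f t) atTop (nhds y)) :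
    Tendsto (fun T : ℝ => ∫ s in Ioc 0 T, Complex.exp (-a * s) • dlG f lam (T - s))
      atTop (nhds (a⁻¹ • y)) := by
  have hint : ∀ u v, IntervalIntegrable
      (fun t : ℝ => Complex.exp (-(lam * t)) • (Ioi (0:ℝ)).indicator f t) volume u v := by
    intro u v
    exact intervalIntegrable_iff.2 ((dl_integrableOn f hfloc lam (max u v)).mono_set
      (fun x hx => (uIoc_subset_uIcc hx).2))
  have hcont : Continuous (dlG f lam) := intervalIntegral.continuous_primitive hint 0
  have hlim : Tendsto (dlG f lam) atTop (nhds y) := by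
    refine hf.congr' ?_
    filter_upwards [eventually_ge_atTop 0] with T hT
    rw [dlG_of_nonneg f lam T hT]
  obtain ⟨C, hC⟩ : ∃ C, ∀ r, ‖dlG f lam r‖ ≤ C := by
    have h1 := hlim.norm.eventually (ge_mem_nhds (lt_add_one ‖y‖))
    obtain ⟨T0, hT0⟩ := eventually_atTop.1 h1
    obtain ⟨C0, hC0⟩ := (isCompact_Icc (a := (0:ℝ)) (b := T0)).exists_bound_of_continuousOn
      hcont.continuousOn
    refine ⟨max (max C0 (‖y‖ + 1)) 0, fun r => ?_⟩
    rcases le_total r 0 with h | h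
    · rw [dlG_of_nonpos f lam r h]; simp
    · rcases le_total r T0 with h' | h'
      · exact (hC0 r ⟨h, h'⟩).trans ((le_max_left _ _).trans (le_max_left _ _))
      · exact (hT0 r h').trans ((le_max_right _ _).trans (le_max_left _ _))
  have hexp : IntegrableOn (fun s : ℝ => Complex.exp (-a * s)) (Ioi 0) :=
    integrableOn_exp_mul_complex_Ioi (by simpa using ha) 0
  have hval : ∫ s in Ioi (0:ℝ), Complex.exp (-a * s) • y = a⁻¹ • y := by
    rw [integral_smul_const, integral_exp_mul_complex_Ioi (by simpa using ha)]
    simp [neg_div_neg_eq]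
  rw [← hval]
  have key : ∀ T : ℝ, ∫ s in Ioc 0 T, Complex.exp (-a * s) • dlG f lam (T - s)
      = ∫ s in Ioi (0:ℝ), Complex.exp (-a * s) • dlG f lam (T - s) := by
    intro T
    refine (setIntegral_eq_of_subset_of_forall_sdiff_eq_zero measurableSet_Ioi
      (fun x hx => hx.1) ?_).symm
    intro x hx
    have : T < x := by
      by_contra h
      exact hx.2 ⟨hx.1, not_lt.1 h⟩
    rw [dlG_of_nonpos f lam _ (by linarith), smul_zero]
  simp_rw [key]
  refine tendsto_integral_filter_of_dominated_convergence
    (fun s : ℝ => ‖Complex.exp (-a * s)‖ * C) ?_ ?_ (hexp.norm.mul_const C) ?_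
  · refine Eventually.of_forall fun T => Continuous.aestronglyMeasurable ?_
    fun_prop
  · refine Eventually.of_forall fun T => Eventually.of_forall fun s => ?_
    rw [norm_smul]
    exact mul_le_mul_of_nonneg_left (hC _) (norm_nonneg _)
  · refine Eventually.of_forall fun s => ?_
    refine Tendsto.const_smul (hlim.comp ?_) _
    exact tendsto_atTop_add_const_right _ _ tendsto_id

lemma dl_inner {X : Type*} [NormedAddCommGroup X] [NormedSpace ℂ X] [CompleteSpace X]
    (f : ℝ → X) (hfloc : LocallyIntegrableOn f (Set.Ici (0:ℝ))) (lam mu : ℂ) (T s : ℝ)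
    (hs : s ∈ Ioc 0 T) :
    ∫ t in Ioc 0 T, Complex.exp (-(lam * t) - mu * s) • (Ioi (0:ℝ)).indicator f (t - s)
      = Complex.exp (-(lam + mu) * s) • dlG f lam (T - s) := by
  have hint : ∀ u v, IntervalIntegrable
      (fun t : ℝ => Complex.exp (-(lam * t)) • (Ioi (0:ℝ)).indicator f t) volume u v := by
    intro u v
    exact intervalIntegrable_iff.2 ((dl_integrableOn f hfloc lam (max u v)).mono_set
      (fun x hx => (uIoc_subset_uIcc hx).2))
  have h0 := dlG_of_nonpos f lam (-s) (by linarith [hs.1])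
  unfold dlG at h0 ⊢
  have hT : 0 ≤ T := hs.1.le.trans hs.2
  rw [← intervalIntegral.integral_of_le hT]
  have h1 : ∀ t : ℝ, Complex.exp (-(lam * t) - mu * s) • (Ioi (0:ℝ)).indicator f (t - s)
      = (fun r : ℝ => Complex.exp (-(lam + mu) * s) •
          (Complex.exp (-(lam * r)) • (Ioi (0:ℝ)).indicator f r)) (t - s) := by
    intro t
    simp only
    rw [smul_smul, ← Complex.exp_add]
    congr 2
    push_cast
    ring
  simp_rw [h1]
  rw [intervalIntegral.integral_comp_sub_right (fun r : ℝ => Complex.exp (-(lam + mu) * s) •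
          (Complex.exp (-(lam * r)) • (Ioi (0:ℝ)).indicator f r)) s,
    intervalIntegral.integral_smul, zero_sub,
    ← intervalIntegral.integral_add_adjacent_intervals (hint (-s) 0) (hint 0 (T - s)),
    intervalIntegral.integral_symm, h0, neg_zero, zero_add]

lemma dl_prod {X : Type*} [NormedAddCommGroup X] [NormedSpace ℂ X]
    (f : ℝ → X) (hfloc : LocallyIntegrableOn f (Set.Ici (0:ℝ))) (lam mu : ℂ) (T : ℝ) :
    Integrable (fun p : ℝ × ℝ =>
        Complex.exp (-(lam * p.1) - mu * p.2) • (Ioi (0:ℝ)).indicator f (p.1 - p.2))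
      ((volume.restrict (Ioc 0 T)).prod (volume.restrict (Ioc 0 T))) := by
  have hφ : Integrable ((Ioc 0 T).indicator (fun s : ℝ => Complex.exp (-(lam + mu) * s))) := by
    rw [integrable_indicator_iff measurableSet_Ioc]
    refine (ContinuousOn.integrableOn_Icc ?_).mono_set Ioc_subset_Icc_self
    fun_prop
  have hψ : Integrable ((Iic T).indicator
      (fun t : ℝ => Complex.exp (-(lam * t)) • (Ioi (0:ℝ)).indicator f t)) := by
    rw [integrable_indicator_iff measurableSet_Iic]
    exact dl_integrableOn f hfloc lam T
  have := (hφ.convolution_integrand (ContinuousLinearMap.lsmul ℝ ℂ) hψ).integrableOn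
    (s := Ioc 0 T ×ˢ Ioc 0 T)
  rw [Measure.prod_restrict]
  refine IntegrableOn.congr_fun this ?_ (measurableSet_Ioc.prod measurableSet_Ioc)
  rintro ⟨t, s⟩ ⟨ht, hs⟩
  simp only at ht hs
  have h2 : t - s ∈ Iic T := by
    have := ht.2
    have := hs.1
    simp only [mem_Iic]
    linarith
  simp only [indicator_of_mem hs, indicator_of_mem h2, ContinuousLinearMap.lsmul_apply]
  rw [smul_smul, ← Complex.exp_add]
  congr 2
  push_cast
  ring

theorem doubleLaplace_fminus
    {X : Type*} [NormedAddCommGroup X] [NormedSpace ℂ X]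
    (f : ℝ → X) (hfloc : LocallyIntegrableOn f (Set.Ici (0:ℝ)))
    (ω : ℝ) (F : ℂ → X)
    (hf : ∀ lam : ℂ, ω < lam.re →
      Tendsto (fun T : ℝ => ∫ t in (0:ℝ)..T, Complex.exp (-(lam * t)) • f t)
        atTop (nhds (F lam)))
    (lam mu : ℂ) (hl : ω < lam.re) (hm : ω < mu.re) (hsum : 0 < (lam + mu).re) :
    Tendsto (fun T : ℝ => ∫ t in (0:ℝ)..T, ∫ s in (0:ℝ)..T,
        Complex.exp (-(lam * t) - mu * s) • f |t - s|)
      atTop (nhds ((lam + mu)⁻¹ • (F lam + F mu))) := by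
  by_cases hX : CompleteSpace X
  swap
  · have hz : ∀ (g : ℝ → X) (a b : ℝ), ∫ t in a..b, g t = 0 := by
      intro g a b
      simp [intervalIntegral, integral_of_not_completeSpace hX]
    simp only [hz] at hf ⊢
    rw [← tendsto_nhds_unique tendsto_const_nhds (hf lam hl),
      ← tendsto_nhds_unique tendsto_const_nhds (hf mu hm)]
    simp
  have h1 := dl_limit f hfloc lam (lam + mu) hsum (F lam) (hf lam hl)
  have h2 := dl_limit f hfloc mu (lam + mu) hsum (F mu) (hf mu hm)
  rw [smul_add]
  refine (h1.add h2).congr' ?_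
  filter_upwards [eventually_ge_atTop 0] with T hT
  simp only [intervalIntegral.integral_of_le hT]
  have hp1 := dl_prod f hfloc lam mu T
  have hp2 := (dl_prod f hfloc mu lam T).swap
  have e1 : ∫ s in Ioc 0 T, Complex.exp (-(lam + mu) * s) • dlG f lam (T - s)
      = ∫ t in Ioc 0 T, ∫ s in Ioc 0 T,
        Complex.exp (-(lam * t) - mu * s) • (Ioi (0:ℝ)).indicator f (t - s) := by
    rw [integral_integral_swap (f := fun t s : ℝ =>
      Complex.exp (-(lam * t) - mu * s) • (Ioi (0:ℝ)).indicator f (t - s)) hp1]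
    refine setIntegral_congr_fun measurableSet_Ioc fun s hs => ?_
    exact (dl_inner f hfloc lam mu T s hs).symm
  have e2 : ∫ s in Ioc 0 T, Complex.exp (-(lam + mu) * s) • dlG f mu (T - s)
      = ∫ t in Ioc 0 T, ∫ s in Ioc 0 T,
        Complex.exp (-(mu * s) - lam * t) • (Ioi (0:ℝ)).indicator f (s - t) := by
    refine setIntegral_congr_fun measurableSet_Ioc fun s hs => ?_
    rw [add_comm lam mu]
    exact (dl_inner f hfloc mu lam T s hs).symm
  rw [e1, e2]
  refine (integral_integral_add hp1 hp2).symm.trans ?_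
  refine integral_congr_ae (Eventually.of_forall fun t => ?_)
  refine integral_congr_ae ?_
  have hne : ∀ᵐ s ∂(volume.restrict (Ioc 0 T)), s ≠ t :=
    ae_restrict_of_ae (Measure.ae_ne volume t)
  filter_upwards [hne] with s hs
  simp only [Prod.swap, Function.comp]
  rcases lt_or_gt_of_ne hs with h | h
  · rw [indicator_of_mem (show t - s ∈ Ioi (0:ℝ) from sub_pos.2 h),
      indicator_of_notMem (show s - t ∉ Ioi (0:ℝ) from fun h' => by have h3 : (0:ℝ) < _ := h'; linarith),
      abs_of_pos (sub_pos.2 h), smul_zero, add_zero]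
  · rw [indicator_of_notMem (show t - s ∉ Ioi (0:ℝ) from fun h' => by have h3 : (0:ℝ) < _ := h'; linarith),
      indicator_of_mem (show s - t ∈ Ioi (0:ℝ) from sub_pos.2 h),
      abs_of_neg (sub_neg.2 h), smul_zero, zero_add, neg_sub]
    congr 2
    ring
end
end

section
/- Let 0 < α < 1, n ∈ ℕ, 0 < τ ≤ ∞, and suppose the closed operator A generates a local (g_α,g_α)-regularized resolvent family {S₁(t)}_{t∈(0,τ)} on a complex Banach space X, where g_α(t) = t^{α−1}/Γ(α). Fix 0 < T < τ and define recursively, for 1 ≤ m ≤ n, S_{m+1}(t) := S_m(t) for t ∈ (0,mT], and S_{m+1}(t)x := (α/Γ(1−α)) ∫₀^{t−mT} ∫₀^{mT} S_m(r₁) S₁(r₂)x · (t−r₁−r₂)^{−1−α} dr₁ dr₂ for t ∈ (mT,(m+1)T], x ∈ X. Then {S_{n+1}(t)}_{t∈(0,(n+1)T]} is a local (g_α,g_α)-regularized resolvent family generated by A; consequently A generates a global (g_α,g_α)-regularized resolvent family {S(t)}_{t>0} extending {S₁(t)}_{t∈(0,τ)}. -/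
open MeasureTheory Filter Set Topology ENNReal Real

noncomputable section

variable {X : Type*} [NormedAddCommGroup X] [NormedSpace ℂ X] [CompleteSpace X]

/-- The Riemann–Liouville kernel `g_α(t) = t^{α−1}/Γ(α)`. -/
def gfun (α : ℝ) (t : ℝ) : ℝ := t ^ (α - 1) / Real.Gamma α

/-- Convolution of a scalar kernel with an operator family applied to a vector. -/
def convOp (a : ℝ → ℝ) (S : ℝ → X →L[ℂ] X) (t : ℝ) (x : X) : X :=
  ∫ s in (0:ℝ)..t, a (t - s) • S s x

/-- `(a,k)`-regularized resolvent family generated by `A` on the time set `I`. -/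
def IsResolventFamily (A : X →ₗ.[ℂ] X) (a k : ℝ → ℝ) (I : Set ℝ)
    (S : ℝ → X →L[ℂ] X) : Prop :=
  (∀ x : X, ContinuousOn (fun t => S t x) I) ∧
  (∀ x : X, Tendsto (fun t => (k t)⁻¹ • S t x) (nhdsWithin 0 (Set.Ioi 0)) (nhds x)) ∧
  (∀ t ∈ I, ∀ x : A.domain, ∃ h : S t (x : X) ∈ A.domain,
      A ⟨S t (x : X), h⟩ = S t (A x)) ∧
  (∀ t ∈ I, ∀ x : X, ∃ h : convOp a S t x ∈ A.domain,
      A ⟨convOp a S t x, h⟩ = S t x - k t • x)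


set_option linter.unusedSectionVars false


lemma ii_congr {E : Type*} [NormedAddCommGroup E] [NormedSpace ℝ E] {a c : ℝ} {f g : ℝ → E}
    (h : a ≤ c) (hfg : ∀ x ∈ Ioo a c, f x = g x) : ∫ x in a..c, f x = ∫ x in a..c, g x := by
  rw [intervalIntegral.integral_of_le h, intervalIntegral.integral_of_le h,
    integral_Ioc_eq_integral_Ioo, integral_Ioc_eq_integral_Ioo]
  exact setIntegral_congr_fun measurableSet_Ioo hfg

lemma ii_integrable_congr {E : Type*} [NormedAddCommGroup E] {a c : ℝ} {f g : ℝ → E}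
    (h : a ≤ c) (hf : IntervalIntegrable f volume a c) (hfg : ∀ x ∈ Ioo a c, f x = g x) :
    IntervalIntegrable g volume a c := by
  rw [intervalIntegrable_iff_integrableOn_Ioo_of_le h] at hf ⊢
  exact hf.congr_fun hfg measurableSet_Ioo

lemma beta_aux {a b : ℝ} (ha : 0 < a) (hb : 0 < b) :
    IntervalIntegrable (fun r : ℝ => r ^ (a - 1) * (1 - r) ^ (b - 1)) volume 0 1 ∧
    ∫ r in (0:ℝ)..1, r ^ (a - 1) * (1 - r) ^ (b - 1) = ProbabilityTheory.beta a b := by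
  have h := Complex.betaIntegral_convergent (u := (a : ℂ)) (v := (b : ℂ)) (by simpa) (by simpa)
  have key : ∀ x ∈ Ioc (0:ℝ) 1, ((x : ℂ) ^ ((a : ℂ) - 1) * (1 - (x : ℂ)) ^ ((b : ℂ) - 1)) =
      ((x ^ (a - 1) * (1 - x) ^ (b - 1) : ℝ) : ℂ) := by
    intro x hx
    rw [Complex.ofReal_mul, Complex.ofReal_cpow hx.1.le, Complex.ofReal_cpow (by linarith [hx.2])]
    push_cast
    rfl
  constructor
  · refine h.norm.congr ?_
    intro x hx
    rw [uIoc_of_le zero_le_one] at hx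
    simp only
    rw [key x hx, Complex.norm_real, Real.norm_of_nonneg]
    have := hx.1
    have h2 : 0 ≤ 1 - x := by linarith [hx.2]
    positivity
  · rw [ProbabilityTheory.beta_eq_betaIntegralReal a b ha hb, Complex.betaIntegral]
    rw [ii_congr (g := fun x : ℝ => ((x ^ (a - 1) * (1 - x) ^ (b - 1) : ℝ) : ℂ)) zero_le_one
      (fun x hx => key x ⟨hx.1, hx.2.le⟩), intervalIntegral.integral_ofReal, Complex.ofReal_re]

lemma beta_int {a b c : ℝ} (ha : 0 < a) (hb : 0 < b) (hc : 0 < c) :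
    IntervalIntegrable (fun r : ℝ => r ^ (a - 1) * (c - r) ^ (b - 1)) volume 0 c ∧
    ∫ r in (0:ℝ)..c, r ^ (a - 1) * (c - r) ^ (b - 1) =
      c ^ (a + b - 1) * ProbabilityTheory.beta a b := by
  obtain ⟨h1, h2⟩ := beta_aux ha hb
  have key : ∀ x ∈ Ioc (0:ℝ) c, (c ^ (a + b - 2)) * ((c⁻¹ * x) ^ (a - 1) * (1 - c⁻¹ * x) ^ (b - 1))
      = x ^ (a - 1) * (c - x) ^ (b - 1) := by
    intro x hx
    have e : 1 - c⁻¹ * x = c⁻¹ * (c - x) := by field_simp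
    have hx2 : 0 ≤ c - x := by linarith [hx.2]
    rw [e, Real.mul_rpow (by positivity) hx.1.le, Real.mul_rpow (by positivity) hx2,
      Real.inv_rpow hc.le, Real.inv_rpow hc.le]
    have : c ^ (a + b - 2) = c ^ (a - 1) * c ^ (b - 1) := by
      rw [← Real.rpow_add hc]; ring_nf
    rw [this]
    field_simp
  constructor
  · have h3 := (h1.comp_mul_left (c := c⁻¹)).const_mul (c ^ (a + b - 2))
    simp only [zero_div, one_div, inv_inv] at h3
    refine h3.congr ?_
    intro x hx
    rw [uIoc_of_le hc.le] at hx
    exact key x hx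
  · rw [← h2, ii_congr hc.le (g := fun x : ℝ => (c ^ (a + b - 2)) * ((c⁻¹ * x) ^ (a - 1) * (1 - c⁻¹ * x) ^ (b - 1)))]
    · rw [intervalIntegral.integral_const_mul,
        intervalIntegral.integral_comp_mul_left (fun y : ℝ => y ^ (a - 1) * (1 - y) ^ (b - 1)) (by positivity)]
      simp only [inv_inv, mul_zero, inv_mul_cancel₀ hc.ne', smul_eq_mul]
      have : c ^ (a + b - 1) = c ^ (a + b - 2) * c := by
        nth_rewrite 3 [← Real.rpow_one c]
        rw [← Real.rpow_add hc]; ring_nf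
      rw [this]; ring
    · intro x hx
      exact (key x ⟨hx.1, hx.2.le⟩).symm

lemma kernel1 {α s q : ℝ} (hα0 : 0 < α) (hs : 0 < s) (hq : 0 < q) :
    IntervalIntegrable (fun σ : ℝ => (s - σ) ^ (α - 1) * (σ + q) ^ (-1 - α)) volume 0 s ∧
    ∫ σ in (0:ℝ)..s, (s - σ) ^ (α - 1) * (σ + q) ^ (-1 - α) = (s / q) ^ α / (α * (s + q)) := by
  have hinteg : IntervalIntegrable (fun σ : ℝ => (s - σ) ^ (α - 1) * (σ + q) ^ (-1 - α)) volume 0 s := by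
    apply IntervalIntegrable.mul_continuousOn
    · have := (beta_int (a := 1) (b := α) (c := s) one_pos hα0 hs).1
      simpa using this
    · intro σ hσ
      rw [uIcc_of_le hs.le] at hσ
      apply ContinuousAt.continuousWithinAt
      apply ContinuousAt.rpow_const (by fun_prop)
      left; linarith [hσ.1]
  refine ⟨hinteg, ?_⟩
  have hF := intervalIntegral.integral_eq_sub_of_hasDerivAt_of_le (f := fun σ : ℝ => -(1 / (α * (s + q))) * ((s - σ) / (σ + q)) ^ α) hs.le ?_ ?_ hinteg
  · rw [hF]
    simp only [sub_self, zero_div, sub_zero, zero_add]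
    rw [Real.zero_rpow hα0.ne']
    ring
  · intro σ hσ
    apply ContinuousAt.continuousWithinAt
    apply ContinuousAt.mul continuousAt_const
    apply ContinuousAt.rpow_const
    · apply ContinuousAt.div (by fun_prop) (by fun_prop)
      linarith [hσ.1]
    · right; exact hα0.le
  · intro σ hσ
    have h1 : 0 < s - σ := by linarith [hσ.2]
    have h2 : 0 < σ + q := by linarith [hσ.1]
    have hd : HasDerivAt (fun σ : ℝ => (s - σ) / (σ + q)) (((-1) * (σ + q) - (s - σ) * 1) / (σ + q) ^ 2) σ := by
      apply HasDerivAt.div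
      · simpa using (hasDerivAt_id σ).const_sub s
      · simpa using (hasDerivAt_id σ).add_const q
      · exact h2.ne'
    have := (hd.rpow_const (p := α) (Or.inl (by positivity))).const_mul (-(1 / (α * (s + q))))
    refine this.congr_deriv ?_
    rw [Real.div_rpow h1.le h2.le]
    have e : (σ + q) ^ (-1 - α) = ((σ + q) ^ (α - 1) * (σ + q) ^ 2)⁻¹ := by
      rw [← Real.rpow_natCast, ← Real.rpow_add h2, ← Real.rpow_neg h2.le]
      norm_num
      ring_nf
    rw [e]
    have : s + q ≠ 0 := by positivity
    have h3 := (Real.rpow_pos_of_pos h2 (α - 1)).ne'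
    field_simp
    ring

lemma kernel2 {α s p : ℝ} (hα0 : 0 < α) (hα1 : α < 1) (hs : 0 < s) (hp : 0 < p) :
    ∫ q in (0:ℝ)..p, (p - q) ^ (α - 1) * (q ^ (-α) * (s ^ α / (s + q))) =
      Real.Gamma α * Real.Gamma (1 - α) * (p + s) ^ (α - 1) := by
  have hb := (beta_aux (a := 1 - α) (b := α) (by linarith) hα0).2
  have hbv : ProbabilityTheory.beta (1 - α) α = Real.Gamma α * Real.Gamma (1 - α) := by
    simp [ProbabilityTheory.beta, mul_comm]
  rw [hbv] at hb
  rw [← hb, ← intervalIntegral.integral_mul_const]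
  rw [intervalIntegral.integral_of_le hp.le, intervalIntegral.integral_of_le zero_le_one,
    integral_Ioc_eq_integral_Ioo, integral_Ioc_eq_integral_Ioo]
  have hD : ∀ w ∈ Ioo (0:ℝ) 1, 0 < s + p - p * w := by
    intro w hw
    nlinarith [hw.2]
  have himg : (fun w : ℝ => p * s * w / (s + p - p * w)) '' Ioo 0 1 = Ioo 0 p := by
    ext q
    constructor
    · rintro ⟨w, hw, rfl⟩
      have := hD w hw
      have h0 := hw.1
      refine ⟨by positivity, ?_⟩
      simp only
      rw [div_lt_iff₀ this]
      nlinarith [mul_pos hp (mul_pos (add_pos hs hp) (sub_pos.2 hw.2))]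
    · rintro ⟨h0, h1⟩
      refine ⟨(s + p) * q / (p * (s + q)), ⟨by positivity, ?_⟩, ?_⟩
      · rw [div_lt_one (by positivity)]
        nlinarith
      · simp only
        have h3 : s + p - p * ((s + p) * q / (p * (s + q))) = s * (s + p) / (s + q) := by
          field_simp
          ring
        rw [h3]
        field_simp
  rw [← himg, integral_image_eq_integral_abs_deriv_smul measurableSet_Ioo (f' := fun w => p * s * (s + p) / (s + p - p * w) ^ 2)]
  · apply setIntegral_congr_fun measurableSet_Ioo
    intro w hw
    have hDw := hD w hw
    have h0 := hw.1
    have h1 : 0 < 1 - w := by linarith [hw.2]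
    simp only [smul_eq_mul]
    set D := s + p - p * w with hDdef
    have e1 : s + p * s * w / D = s * (s + p) / D := by
      field_simp; rw [hDdef]; ring
    have e2 : p - p * s * w / D = p * (s + p) * (1 - w) / D := by
      field_simp; rw [hDdef]; ring
    rw [e1, e2, abs_of_pos (by positivity)]
    have hsp : 0 < s + p := by positivity
    rw [Real.div_rpow (by positivity) hDw.le, Real.div_rpow (by positivity) hDw.le,
      Real.mul_rpow (by positivity) h1.le, Real.mul_rpow hp.le hsp.le,
      Real.mul_rpow (by positivity) h0.le, Real.mul_rpow hp.le hs.le]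
    rw [show (1 - α - 1) = -α by ring, show p + s = s + p by ring]
    rw [Real.rpow_neg hp.le, Real.rpow_neg hs.le, Real.rpow_neg hDw.le, Real.rpow_sub hDw, Real.rpow_sub hp]
    simp only [Real.rpow_one]
    have g1 := (Real.rpow_pos_of_pos hDw α).ne'
    have g2 := (Real.rpow_pos_of_pos hp α).ne'
    have g3 := (Real.rpow_pos_of_pos hs α).ne'
    field_simp
  · intro w hw
    have hDw := hD w hw
    apply HasDerivAt.hasDerivWithinAt
    have h1 : HasDerivAt (fun w : ℝ => p * s * w) (p * s) w := by
      simpa using (hasDerivAt_id w).const_mul (p * s)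
    have h2 : HasDerivAt (fun w : ℝ => s + p - p * w) (-p) w := by
      simpa using ((hasDerivAt_id w).const_mul p).const_sub (s + p)
    refine (h1.div h2 hDw.ne').congr_deriv ?_
    ring
  · intro w hw v hv h
    have h1 := hD w hw
    have h2 := hD v hv
    simp only at h
    rw [div_eq_div_iff h1.ne' h2.ne'] at h
    have : (p * s * (s + p)) * (w - v) = 0 := by linarith
    have h3 : p * s * (s + p) ≠ 0 := by positivity
    rcases mul_eq_zero.1 this with h4 | h4
    · exact absurd h4 h3
    · linarith


/-- open simplex -/
def simplexSet (s : ℝ) : Set (ℝ × ℝ) := {p | 0 < p.1 ∧ 0 < p.2 ∧ p.1 + p.2 < s}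

lemma isOpen_simplexSet (s : ℝ) : IsOpen (simplexSet s) := by
  have h1 : IsOpen {p : ℝ × ℝ | 0 < p.1} := isOpen_lt continuous_const continuous_fst
  have h2 : IsOpen {p : ℝ × ℝ | 0 < p.2} := isOpen_lt continuous_const continuous_snd
  have h3 : IsOpen {p : ℝ × ℝ | p.1 + p.2 < s} :=
    isOpen_lt (continuous_fst.add continuous_snd) continuous_const
  exact h1.inter (h2.inter h3)

lemma simplex_slice_r {E : Type*} [NormedAddCommGroup E] [NormedSpace ℝ E] (K : ℝ → ℝ → E) (s σ : ℝ) :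
    (fun r => (simplexSet s).indicator (Function.uncurry K) (σ, r)) =
      if σ ∈ Ioo 0 s then (Ioo 0 (s - σ)).indicator (K σ) else 0 := by
  funext r
  by_cases h : (σ, r) ∈ simplexSet s
  · rw [indicator_of_mem h]
    obtain ⟨h1, h2, h3⟩ := h
    simp only at h1 h2 h3
    rw [if_pos ⟨h1, by linarith⟩, indicator_of_mem (show r ∈ Ioo 0 (s - σ) from ⟨h2, by linarith⟩)]
    rfl
  · rw [indicator_of_notMem h]
    split_ifs with h1
    · rw [indicator_of_notMem]
      intro h2
      exact h ⟨h1.1, h2.1, by simp only; linarith [h2.2]⟩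
    · rfl

lemma simplex_slice_σ {E : Type*} [NormedAddCommGroup E] [NormedSpace ℝ E] (K : ℝ → ℝ → E) (s r : ℝ) :
    (fun σ => (simplexSet s).indicator (Function.uncurry K) (σ, r)) =
      if r ∈ Ioo 0 s then (Ioo 0 (s - r)).indicator (fun σ => K σ r) else 0 := by
  funext σ
  by_cases h : (σ, r) ∈ simplexSet s
  · rw [indicator_of_mem h]
    obtain ⟨h1, h2, h3⟩ := h
    simp only at h1 h2 h3
    rw [if_pos ⟨h2, by linarith⟩, indicator_of_mem (show σ ∈ Ioo 0 (s - r) from ⟨h1, by linarith⟩)]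
    rfl
  · rw [indicator_of_notMem h]
    split_ifs with h1
    · rw [indicator_of_notMem]
      intro h2
      exact h ⟨h2.1, h1.1, by simp only; linarith [h2.2]⟩
    · rfl

lemma simplex_slice_q {E : Type*} [NormedAddCommGroup E] [NormedSpace ℝ E] (K : ℝ → ℝ → E) (s q : ℝ) :
    (fun r => (simplexSet s).indicator (Function.uncurry K) (q - r, r)) =
      if q ∈ Ioo 0 s then (Ioo 0 q).indicator (fun r => K (q - r) r) else 0 := by
  funext r
  by_cases h : (q - r, r) ∈ simplexSet s
  · rw [indicator_of_mem h]
    obtain ⟨h1, h2, h3⟩ := h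
    simp only at h1 h2 h3
    rw [if_pos ⟨by linarith, by linarith⟩, indicator_of_mem (show r ∈ Ioo 0 q from ⟨h2, by linarith⟩)]
    rfl
  · rw [indicator_of_notMem h]
    split_ifs with h1
    · rw [indicator_of_notMem]
      intro h2
      exact h ⟨by simp only; linarith [h2.2], h2.1, by simp only; linarith [h1.2]⟩
    · rfl

lemma integral_if_ind {E : Type*} [NormedAddCommGroup E] [NormedSpace ℝ E] (f : ℝ → E) (s σ c : ℝ)
    (hc : σ ∈ Ioo 0 s → 0 ≤ c) :
    ∫ r, (if σ ∈ Ioo 0 s then (Ioo 0 c).indicator f else 0 : ℝ → E) r =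
      (Ioo 0 s).indicator (fun _ => ∫ r in (0:ℝ)..c, f r) σ := by
  by_cases h : σ ∈ Ioo 0 s
  · rw [if_pos h, indicator_of_mem h, integral_indicator measurableSet_Ioo,
      intervalIntegral.integral_of_le (hc h), integral_Ioc_eq_integral_Ioo]
  · rw [if_neg h, indicator_of_notMem h]
    simp

lemma simplex_fubini {E : Type*} [NormedAddCommGroup E] [NormedSpace ℝ E] (K : ℝ → ℝ → E) {s : ℝ} (hs : 0 < s)
    (hK : IntegrableOn (Function.uncurry K) (simplexSet s)) :
    (∫ σ in (0:ℝ)..s, ∫ r in (0:ℝ)..(s - σ), K σ r = ∫ r in (0:ℝ)..s, ∫ σ in (0:ℝ)..(s - r), K σ r) ∧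
    (∫ q in (0:ℝ)..s, ∫ r in (0:ℝ)..q, K (q - r) r = ∫ r in (0:ℝ)..s, ∫ σ in (0:ℝ)..(s - r), K σ r) ∧
    IntervalIntegrable (fun σ => ∫ r in (0:ℝ)..(s - σ), K σ r) volume 0 s ∧
    IntervalIntegrable (fun r => ∫ σ in (0:ℝ)..(s - r), K σ r) volume 0 s := by
  set H := (simplexSet s).indicator (Function.uncurry K) with hH
  have hHi : Integrable H (volume.prod volume) := by
    rw [hH, integrable_indicator_iff (isOpen_simplexSet s).measurableSet]
    rw [← Measure.volume_eq_prod]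
    exact hK
  have e1 : ∀ σ, ∫ r, H (σ, r) = (Ioo 0 s).indicator (fun σ => ∫ r in (0:ℝ)..(s - σ), K σ r) σ := by
    intro σ
    have := congrArg (fun f : ℝ → E => ∫ r, f r) (simplex_slice_r K s σ)
    rw [hH, this, integral_if_ind _ _ _ _ (fun h => by linarith [h.2])]
    simp only [indicator]
  have e2 : ∀ r, ∫ σ, H (σ, r) = (Ioo 0 s).indicator (fun r => ∫ σ in (0:ℝ)..(s - r), K σ r) r := by
    intro r
    have := congrArg (fun f : ℝ → E => ∫ r, f r) (simplex_slice_σ K s r)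
    rw [hH, this, integral_if_ind _ _ _ _ (fun h => by linarith [h.2])]
    simp only [indicator]
  have e3 : ∀ q, ∫ r, H (q - r, r) = (Ioo 0 s).indicator (fun q => ∫ r in (0:ℝ)..q, K (q - r) r) q := by
    intro r
    have := congrArg (fun f : ℝ → E => ∫ r, f r) (simplex_slice_q K s r)
    rw [hH, this, integral_if_ind _ _ _ _ (fun h => h.1.le)]
    simp only [indicator]
  have conv : ∀ f : ℝ → E, ∫ x in (0:ℝ)..s, f x = ∫ x, (Ioo 0 s).indicator f x := by
    intro f
    rw [integral_indicator measurableSet_Ioo,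
      intervalIntegral.integral_of_le hs.le, integral_Ioc_eq_integral_Ioo]
  have convI : ∀ f : ℝ → E, IntervalIntegrable f volume 0 s ↔ Integrable ((Ioo 0 s).indicator f) := by
    intro f
    rw [intervalIntegrable_iff_integrableOn_Ioo_of_le hs.le, integrable_indicator_iff measurableSet_Ioo]
  refine ⟨?_, ?_, ?_, ?_⟩
  · rw [conv, conv]
    simp_rw [← e1, ← e2]
    exact integral_integral_swap (f := fun x y => H (x, y)) hHi
  · rw [conv, conv]
    simp_rw [← e2, ← e3]
    have hmp := measurePreserving_sub_prod (volume : Measure ℝ) (volume : Measure ℝ)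
    have hi : Integrable (fun z : ℝ × ℝ => H (z.1 - z.2, z.2)) (volume.prod volume) :=
      hmp.integrable_comp_of_integrable hHi
    rw [integral_integral_swap (f := fun x y => H (x - y, y)) hi]
    congr 1
    funext r
    exact integral_sub_right_eq_self (fun x => H (x, r)) r
  · rw [convI]
    have := hHi.integral_prod_left
    simpa only [e1] using this
  · rw [convI]
    have := hHi.integral_prod_right
    simpa only [e2] using this

lemma simplex_beta {a b c s : ℝ} (ha : 0 < a) (hb : 0 < b) (hc : 0 < c) (hs : 0 < s) :
    IntegrableOn (Function.uncurry fun σ r : ℝ => (s - σ - r) ^ (a - 1) * σ ^ (b - 1) * r ^ (c - 1)) (simplexSet s) := by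
  rw [← integrable_indicator_iff (isOpen_simplexSet s).measurableSet]
  have hm : Measurable (Function.uncurry fun σ r : ℝ => (s - σ - r) ^ (a - 1) * σ ^ (b - 1) * r ^ (c - 1)) := by
    unfold Function.uncurry
    fun_prop
  rw [Measure.volume_eq_prod, integrable_prod_iff' ((hm.indicator (isOpen_simplexSet s).measurableSet).aestronglyMeasurable)]
  have hB : ∀ r ∈ Ioo 0 s, IntervalIntegrable (fun σ : ℝ => (s - σ - r) ^ (a - 1) * σ ^ (b - 1) * r ^ (c - 1)) volume 0 (s - r) ∧
      ∫ σ in (0:ℝ)..(s - r), (s - σ - r) ^ (a - 1) * σ ^ (b - 1) * r ^ (c - 1) = (r ^ (c - 1) * (s - r) ^ ((a + b) - 1)) * ProbabilityTheory.beta b a := by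
    intro r hr
    obtain ⟨h1, h2⟩ := beta_int hb ha (sub_pos.2 hr.2)
    have e : (fun σ : ℝ => (s - σ - r) ^ (a - 1) * σ ^ (b - 1) * r ^ (c - 1)) =
        fun σ : ℝ => (σ ^ (b - 1) * (s - r - σ) ^ (a - 1)) * r ^ (c - 1) := by
      funext σ
      rw [show s - σ - r = s - r - σ by ring]
      ring
    rw [e]
    refine ⟨h1.mul_const _, ?_⟩
    rw [intervalIntegral.integral_mul_const, h2, add_comm b a]
    ring
  constructor
  · refine Eventually.of_forall fun r => ?_
    rw [simplex_slice_σ]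
    split_ifs with h
    · rw [integrable_indicator_iff measurableSet_Ioo, ← intervalIntegrable_iff_integrableOn_Ioo_of_le (by linarith [h.2])]
      exact (hB r h).1
    · exact integrable_zero _ _ _
  · have e : (fun y : ℝ => ∫ x : ℝ, ‖(simplexSet s).indicator (Function.uncurry fun σ r : ℝ => (s - σ - r) ^ (a - 1) * σ ^ (b - 1) * r ^ (c - 1)) (x, y)‖) =
        (Ioo 0 s).indicator (fun r => (r ^ (c - 1) * (s - r) ^ ((a + b) - 1)) * ProbabilityTheory.beta b a) := by
      funext r
      have : ∀ x, ‖(simplexSet s).indicator (Function.uncurry fun σ r : ℝ => (s - σ - r) ^ (a - 1) * σ ^ (b - 1) * r ^ (c - 1)) (x, r)‖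
          = (simplexSet s).indicator (Function.uncurry fun σ r : ℝ => (s - σ - r) ^ (a - 1) * σ ^ (b - 1) * r ^ (c - 1)) (x, r) := by
        intro x
        apply Real.norm_of_nonneg
        apply indicator_nonneg
        rintro ⟨σ, r⟩ ⟨h1, h2, h3⟩
        simp only at h1 h2 h3
        have : 0 < s - σ - r := by linarith
        simp only [Function.uncurry]
        positivity
      simp_rw [this]
      have := congrArg (fun f : ℝ → ℝ => ∫ r, f r) (simplex_slice_σ (fun σ r : ℝ => (s - σ - r) ^ (a - 1) * σ ^ (b - 1) * r ^ (c - 1)) s r)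
      rw [this, integral_if_ind _ _ _ _ (fun h => by linarith [h.2])]
      by_cases h : r ∈ Ioo 0 s
      · rw [indicator_of_mem h, indicator_of_mem h, (hB r h).2]
      · rw [indicator_of_notMem h, indicator_of_notMem h]
    rw [e, integrable_indicator_iff measurableSet_Ioo, ← intervalIntegrable_iff_integrableOn_Ioo_of_le hs.le]
    exact (beta_int hc (add_pos ha hb) hs).1.mul_const _


/-- bounded strongly continuous operator function -/
def SC (Q : ℝ → X →L[ℂ] X) : Prop := (∀ x, Continuous fun t => Q t x) ∧ ∃ C, ∀ t, ‖Q t‖ ≤ C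

/-- bounded continuous vector function -/
def BC (U : ℝ → X) : Prop := Continuous U ∧ ∃ C, ∀ t, ‖U t‖ ≤ C

/-- operator family with power singularity at zero -/
def Reg (b L : ℝ) (G : ℝ → X →L[ℂ] X) : Prop :=
  ∃ Q : ℝ → X →L[ℂ] X, SC Q ∧ ∀ t ∈ Ioc 0 L, G t = t ^ (b - 1) • Q t

/-- vector function with power singularity at zero -/
def RegV (b L : ℝ) (u : ℝ → X) : Prop :=
  ∃ U : ℝ → X, BC U ∧ ∀ t ∈ Ioc 0 L, u t = t ^ (b - 1) • U t

lemma SC.joint {Q : ℝ → X →L[ℂ] X} (h : SC Q) : Continuous fun p : ℝ × X => Q p.1 p.2 := by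
  obtain ⟨h1, C, hC⟩ := h
  rw [continuous_iff_continuousAt]
  rintro ⟨t0, y0⟩
  rw [ContinuousAt, tendsto_iff_norm_sub_tendsto_zero]
  have hlim : Tendsto (fun p : ℝ × X => C * ‖p.2 - y0‖ + ‖Q p.1 y0 - Q t0 y0‖) (𝓝 (t0, y0)) (𝓝 0) := by
    have hc : Continuous (fun p : ℝ × X => C * ‖p.2 - y0‖ + ‖Q p.1 y0 - Q t0 y0‖) := by
      have := (h1 y0).comp (continuous_fst (X := ℝ) (Y := X))
      simp only [Function.comp_def] at this
      fun_prop
    have := hc.tendsto (t0, y0)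
    simpa using this
  refine squeeze_zero (fun _ => norm_nonneg _) (fun p => ?_) hlim
  have e : Q p.1 p.2 - Q t0 y0 = Q p.1 (p.2 - y0) + (Q p.1 y0 - Q t0 y0) := by
    rw [map_sub]; abel
  simp only
  rw [e]
  refine (norm_add_le _ _).trans ?_
  gcongr
  exact (Q p.1).le_of_opNorm_le (hC _) _

lemma SC.comp {Q : ℝ → X →L[ℂ] X} (h : SC Q) {Y : Type*} [TopologicalSpace Y] {f : Y → ℝ} {g : Y → X}
    (hf : Continuous f) (hg : Continuous g) : Continuous fun y => Q (f y) (g y) :=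
  h.joint.comp (hf.prodMk hg)

lemma SC.bc {Q : ℝ → X →L[ℂ] X} (h : SC Q) (x : X) : BC fun t => Q t x := by
  obtain ⟨h1, C, hC⟩ := h
  exact ⟨h1 x, C * ‖x‖, fun t => (Q t).le_of_opNorm_le (hC _) _⟩

lemma Reg.regV {b L : ℝ} {G : ℝ → X →L[ℂ] X} (h : Reg b L G) (x : X) : RegV b L fun t => G t x := by
  obtain ⟨Q, hQ, h2⟩ := h
  exact ⟨_, hQ.bc x, fun t ht => by simp [h2 t ht]⟩

lemma Reg.mono {b L L' : ℝ} {G : ℝ → X →L[ℂ] X} (h : Reg b L G) (hL : L' ≤ L) : Reg b L' G := by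
  obtain ⟨Q, hQ, h2⟩ := h
  exact ⟨Q, hQ, fun t ht => h2 t ⟨ht.1, ht.2.trans hL⟩⟩

lemma RegV.mono {b L L' : ℝ} {G : ℝ → X} (h : RegV b L G) (hL : L' ≤ L) : RegV b L' G := by
  obtain ⟨Q, hQ, h2⟩ := h
  exact ⟨Q, hQ, fun t ht => h2 t ⟨ht.1, ht.2.trans hL⟩⟩

lemma RegV.sub {b L : ℝ} {u v : ℝ → X} (h : RegV b L u) (h' : RegV b L v) :
    RegV b L fun t => u t - v t := by
  obtain ⟨U, ⟨hU, C, hC⟩, h2⟩ := h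
  obtain ⟨V, ⟨hV, D, hD⟩, h2'⟩ := h'
  refine ⟨fun t => U t - V t, ⟨hU.sub hV, C + D, fun t => (norm_sub_le _ _).trans (add_le_add (hC t) (hD t))⟩, ?_⟩
  intro t ht
  simp only [h2 t ht, h2' t ht, smul_sub]

lemma regV_gfun (α L : ℝ) (x : X) : RegV α L fun t => gfun α t • x := by
  refine ⟨fun _ => (Real.Gamma α)⁻¹ • x, ⟨continuous_const, _, fun t => le_rfl⟩, ?_⟩
  intro t ht
  simp only [gfun, smul_smul, div_eq_mul_inv]

lemma sc_extend {L : ℝ} (hL : 0 ≤ L) (E : ℝ → X →L[ℂ] X) (hE : ∀ x, ContinuousOn (fun t => E t x) (Icc 0 L)) :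
    ∃ Q : ℝ → X →L[ℂ] X, SC Q ∧ ∀ t ∈ Icc 0 L, Q t = E t := by
  refine ⟨fun t => E (projIcc 0 L hL t), ⟨fun x => ?_, ?_⟩, fun t ht => ?_⟩
  · exact (hE x).comp_continuous (continuous_subtype_val.comp continuous_projIcc) (fun t => (projIcc 0 L hL t).2)
  · apply banach_steinhaus
    intro x
    obtain ⟨C, hC⟩ := isCompact_Icc.exists_bound_of_continuousOn (hE x)
    exact ⟨C, fun t => hC _ (projIcc 0 L hL t).2⟩
  · simp only [projIcc_of_mem hL ht]

lemma reg_simplex {a b c s : ℝ} (ha : 0 < a) (hb : 0 < b) (hc : 0 < c) (hs : 0 < s)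
    {G : ℝ → X →L[ℂ] X} {u : ℝ → X} (hG : Reg b s G) (hu : RegV c s u) :
    IntegrableOn (Function.uncurry fun σ r : ℝ => gfun a (s - σ - r) • G σ (u r)) (simplexSet s) := by
  obtain ⟨Q, hQ, hGQ⟩ := hG
  obtain ⟨U, ⟨hU, D, hD⟩, huU⟩ := hu
  have hQ' := hQ
  obtain ⟨hQ1, C, hC⟩ := hQ'
  have hM := (simplex_beta ha hb hc hs).mul_const ((Real.Gamma a)⁻¹ * (C * D))
  have hms := (isOpen_simplexSet s).measurableSet
  have e : EqOn (Function.uncurry fun σ r : ℝ => ((s - σ - r) ^ (a - 1) * σ ^ (b - 1) * r ^ (c - 1) * (Real.Gamma a)⁻¹) • Q σ (U r))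
     (Function.uncurry fun σ r : ℝ => gfun a (s - σ - r) • G σ (u r)) (simplexSet s) := by
    rintro ⟨σ, r⟩ ⟨h1, h2, h3⟩
    simp only at h1 h2 h3
    simp only [Function.uncurry]
    rw [hGQ σ ⟨h1, by linarith⟩, huU r ⟨h2, by linarith⟩]
    simp only [_root_.smul_apply, ContinuousLinearMap.map_smul_of_tower, smul_smul, gfun]
    congr 1
    ring
  refine IntegrableOn.congr_fun ?_ e hms
  refine Integrable.mono' hM ?_ ?_
  · have h1 : Measurable (fun a_1 : ℝ × ℝ => (s - a_1.1 - a_1.2) ^ (a - 1) * a_1.1 ^ (b - 1) * a_1.2 ^ (c - 1) * (Real.Gamma a)⁻¹) := by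
      fun_prop
    have h2 := (hQ.comp continuous_fst (hU.comp continuous_snd)).aestronglyMeasurable (μ := volume.restrict (simplexSet s))
    exact h1.aestronglyMeasurable.smul h2
  · refine (ae_restrict_iff' hms).2 (Eventually.of_forall ?_)
    rintro ⟨σ, r⟩ ⟨h1, h2, h3⟩
    simp only at h1 h2 h3
    simp only [Function.uncurry]
    have h4 : 0 < s - σ - r := by linarith
    have hG := Real.Gamma_pos_of_pos ha
    rw [norm_smul, Real.norm_of_nonneg (by positivity), ← mul_assoc]
    gcongr
    exact (Q σ).le_of_opNorm_le_of_le (hC _) (hD _)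

lemma reg_beta {b c s : ℝ} (hb : 0 < b) (hc : 0 < c) (hs : 0 < s)
    {G : ℝ → X →L[ℂ] X} {u : ℝ → X} (hG : Reg b s G) (hu : RegV c s u) :
    IntervalIntegrable (fun σ : ℝ => G σ (u (s - σ))) volume 0 s := by
  obtain ⟨Q, hQ, hGQ⟩ := hG
  obtain ⟨U, ⟨hU, D, hD⟩, huU⟩ := hu
  have hQ' := hQ
  obtain ⟨hQ1, C, hC⟩ := hQ'
  have hM := (beta_int hb hc hs).1.mul_const (C * D)
  have e : ∀ σ ∈ Ioo 0 s, (σ ^ (b - 1) * (s - σ) ^ (c - 1)) • Q σ (U (s - σ)) = G σ (u (s - σ)) := by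
    intro σ hσ
    rw [hGQ σ ⟨hσ.1, hσ.2.le⟩, huU (s - σ) ⟨by linarith [hσ.2], by linarith [hσ.1]⟩]
    simp only [_root_.smul_apply, ContinuousLinearMap.map_smul_of_tower, smul_smul]
  refine ii_integrable_congr hs.le ?_ e
  rw [intervalIntegrable_iff_integrableOn_Ioo_of_le hs.le] at hM ⊢
  refine Integrable.mono' hM ?_ ?_
  · have h1 : Measurable (fun σ : ℝ => σ ^ (b - 1) * (s - σ) ^ (c - 1)) := by fun_prop
    have h3 : Continuous fun σ : ℝ => s - σ := by fun_prop
    have h2 := (hQ.comp continuous_id (hU.comp h3)).aestronglyMeasurable (μ := volume.restrict (Ioo 0 s))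
    exact h1.aestronglyMeasurable.smul h2
  · refine (ae_restrict_iff' measurableSet_Ioo).2 (Eventually.of_forall ?_)
    intro σ hσ
    have h1 := hσ.1
    have h2 : 0 < s - σ := by linarith [hσ.2]
    rw [norm_smul, Real.norm_of_nonneg (by positivity)]
    gcongr
    exact (Q σ).le_of_opNorm_le_of_le (hC _) (hD _)

lemma RegV.integrable {c s : ℝ} (hc : 0 < c) (hs : 0 < s) {u : ℝ → X} (hu : RegV c s u) :
    IntervalIntegrable u volume 0 s := by
  have h1 : Reg 1 s (fun _ => ContinuousLinearMap.id ℂ X) :=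
    ⟨fun _ => ContinuousLinearMap.id ℂ X, ⟨fun x => continuous_const, _, fun t => le_rfl⟩, fun t ht => by simp⟩
  have h2 := (reg_beta one_pos hc hs h1 hu).comp_sub_left s
  simp only [ContinuousLinearMap.id_apply, sub_zero, sub_self] at h2
  exact ii_integrable_congr hs.le h2.symm (fun x _ => by rw [_root_.sub_sub_cancel])

lemma graph_integral {A : X →ₗ.[ℂ] X} (hA : IsClosed (A.graph : Set (X × X))) {a b : ℝ} (hab : a ≤ b) {f g : ℝ → X}
    (hf : IntervalIntegrable f volume a b) (hg : IntervalIntegrable g volume a b)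
    (h : ∀ t ∈ Ioo a b, (f t, g t) ∈ A.graph) : (∫ t in a..b, f t, ∫ t in a..b, g t) ∈ A.graph := by
  rw [intervalIntegrable_iff_integrableOn_Ioo_of_le hab] at hf hg
  rw [intervalIntegral.integral_of_le hab, intervalIntegral.integral_of_le hab,
    integral_Ioc_eq_integral_Ioo, integral_Ioc_eq_integral_Ioo]
  rw [← integral_pair hf hg]
  have : IsClosed (A.graph : Set (X × X)) := hA
  rw [← Submodule.Quotient.mk_eq_zero]
  have h1 := (A.graph.mkQL).integral_comp_comm (hf.prodMk hg)
  have h2 : ∫ t in Ioo a b, A.graph.mkQL (f t, g t) = 0 := by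
    rw [setIntegral_congr_fun measurableSet_Ioo (g := fun _ => 0)]
    · simp
    · intro t ht
      exact (Submodule.Quotient.mk_eq_zero _).2 (h t ht)
  rw [h2] at h1
  exact h1.symm


lemma res_comm {A : X →ₗ.[ℂ] X} {a k : ℝ → ℝ} {I : Set ℝ} {S : ℝ → X →L[ℂ] X}
    (h : IsResolventFamily A a k I S) {t : ℝ} (ht : t ∈ I) {x y : X} (hxy : (x, y) ∈ A.graph) :
    (S t x, S t y) ∈ A.graph := by
  rw [LinearPMap.mem_graph_iff] at hxy ⊢
  obtain ⟨z, hz1, hz2⟩ := hxy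
  simp only at hz1 hz2
  subst hz1 hz2
  obtain ⟨h1, h2⟩ := h.2.2.1 t ht z
  exact ⟨⟨_, h1⟩, rfl, h2⟩

lemma res_conv {A : X →ₗ.[ℂ] X} {a k : ℝ → ℝ} {I : Set ℝ} {S : ℝ → X →L[ℂ] X}
    (h : IsResolventFamily A a k I S) {t : ℝ} (ht : t ∈ I) (x : X) :
    (convOp a S t x, S t x - k t • x) ∈ A.graph := by
  rw [LinearPMap.mem_graph_iff]
  obtain ⟨h1, h2⟩ := h.2.2.2 t ht x
  exact ⟨⟨_, h1⟩, rfl, h2⟩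

lemma exists_of_graph {A : X →ₗ.[ℂ] X} {x y : X} (h : (x, y) ∈ A.graph) :
    ∃ h : x ∈ A.domain, A ⟨x, h⟩ = y := by
  rw [LinearPMap.mem_graph_iff] at h
  obtain ⟨z, hz1, hz2⟩ := h
  simp only at hz1 hz2
  subst hz1 hz2
  exact ⟨z.2, rfl⟩

lemma res_mk {A : X →ₗ.[ℂ] X} {a k : ℝ → ℝ} {I : Set ℝ} {S : ℝ → X →L[ℂ] X}
    (h1 : ∀ x : X, ContinuousOn (fun t => S t x) I)
    (h2 : ∀ x : X, Tendsto (fun t => (k t)⁻¹ • S t x) (nhdsWithin 0 (Set.Ioi 0)) (nhds x))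
    (h3 : ∀ t ∈ I, ∀ x y, (x, y) ∈ A.graph → (S t x, S t y) ∈ A.graph)
    (h4 : ∀ t ∈ I, ∀ x, (convOp a S t x, S t x - k t • x) ∈ A.graph) :
    IsResolventFamily A a k I S :=
  ⟨h1, h2, fun t ht x => exists_of_graph (h3 t ht _ _ (A.mem_graph x)), fun t ht x => exists_of_graph (h4 t ht x)⟩

lemma res_mono {A : X →ₗ.[ℂ] X} {a k : ℝ → ℝ} {I J : Set ℝ} {S : ℝ → X →L[ℂ] X}
    (h : IsResolventFamily A a k I S) (hJ : J ⊆ I) : IsResolventFamily A a k J S :=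
  ⟨fun x => (h.1 x).mono hJ, h.2.1, fun t ht => h.2.2.1 t (hJ ht), fun t ht => h.2.2.2 t (hJ ht)⟩

lemma convOp_congr {a : ℝ → ℝ} {S S' : ℝ → X →L[ℂ] X} {t : ℝ} (ht : 0 ≤ t)
    (h : ∀ r ∈ Ioc 0 t, S' r = S r) (x : X) : convOp a S' t x = convOp a S t x := by
  unfold convOp
  apply ii_congr ht
  intro r hr
  rw [h r ⟨hr.1, hr.2.le⟩]

lemma tendsto_congr_fam {k : ℝ → ℝ} {L : ℝ} (hL : 0 < L) {S S' : ℝ → X →L[ℂ] X}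
    (hSS : ∀ r ∈ Ioc 0 L, S' r = S r) {x : X}
    (h : Tendsto (fun t => (k t)⁻¹ • S t x) (nhdsWithin 0 (Set.Ioi 0)) (nhds x)) :
    Tendsto (fun t => (k t)⁻¹ • S' t x) (nhdsWithin 0 (Set.Ioi 0)) (nhds x) := by
  refine h.congr' ?_
  filter_upwards [Ioc_mem_nhdsGT hL] with t ht
  rw [hSS t ht]

lemma res_norm {A : X →ₗ.[ℂ] X} {α L : ℝ} (hα0 : 0 < α) (hL : 0 < L) {S : ℝ → X →L[ℂ] X}
    (h : IsResolventFamily A (gfun α) (gfun α) (Ioc 0 L) S) :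
    ∃ Q : ℝ → X →L[ℂ] X, SC Q ∧ Q 0 = (Real.Gamma α)⁻¹ • ContinuousLinearMap.id ℂ X ∧
      ∀ t ∈ Ioc 0 L, S t = t ^ (α - 1) • Q t := by
  have hΓ := Real.Gamma_pos_of_pos hα0
  set E : ℝ → X →L[ℂ] X := fun t => if t = 0 then (Real.Gamma α)⁻¹ • ContinuousLinearMap.id ℂ X else
    t ^ (1 - α) • S t with hE
  have hpos : ∀ t, t ≠ 0 → E t = t ^ (1 - α) • S t := fun t ht => by simp [hE, ht]
  have hcont : ∀ x, ContinuousOn (fun t => E t x) (Icc 0 L) := by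
    intro x t ht
    rcases eq_or_lt_of_le ht.1 with h0 | h0
    · subst h0
      have h1 : Tendsto (fun t => E t x) (𝓝[>] 0) (𝓝 (E 0 x)) := by
        have := (h.2.1 x).const_smul (Real.Gamma α)⁻¹
        have e0 : E 0 x = (Real.Gamma α)⁻¹ • x := by simp [hE]
        rw [e0]
        refine this.congr' ?_
        filter_upwards [self_mem_nhdsWithin] with t ht
        have ht' : 0 < t := ht
        rw [hpos t ht'.ne', smul_smul, _root_.smul_apply]
        congr 1
        rw [gfun, inv_div, ← mul_div_assoc, inv_mul_cancel₀ hΓ.ne', one_div, ← Real.rpow_neg ht'.le]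
        congr 1; ring
      have h2 : ContinuousWithinAt (fun t => E t x) (insert 0 (Ioi 0)) 0 :=
        continuousWithinAt_insert_self.2 h1
      refine h2.mono ?_
      intro y hy
      rcases eq_or_lt_of_le hy.1 with h | h
      · left; exact h.symm
      · right; exact h
    · have h1 : ContinuousWithinAt (fun t => S t x) (Ioc 0 L) t := h.1 x t ⟨h0, ht.2⟩
      have h2 : ContinuousWithinAt (fun t => E t x) (Ioc 0 L) t := by
        have h3 : ContinuousWithinAt (fun t : ℝ => t ^ (1 - α) • S t x) (Ioc 0 L) t :=
          (Real.continuousAt_rpow_const t _ (Or.inl h0.ne')).continuousWithinAt.smul h1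
        refine h3.congr (fun y hy => ?_) ?_
        · rw [hpos y hy.1.ne']; rfl
        · rw [hpos t h0.ne']; rfl
      refine h2.mono_of_mem_nhdsWithin ?_
      rw [mem_nhdsWithin]
      exact ⟨Ioi 0, isOpen_Ioi, h0, fun y hy => ⟨hy.1, hy.2.2⟩⟩
  obtain ⟨Q, hQ, hQE⟩ := sc_extend hL.le E hcont
  refine ⟨Q, hQ, ?_, ?_⟩
  · rw [hQE 0 ⟨le_rfl, hL.le⟩]; simp [hE]
  · intro t ht
    rw [hQE t ⟨ht.1.le, ht.2⟩, hpos t ht.1.ne', smul_smul, ← Real.rpow_add ht.1]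
    simp

lemma res_reg {A : X →ₗ.[ℂ] X} {α L : ℝ} (hα0 : 0 < α) (hL : 0 < L) {S : ℝ → X →L[ℂ] X}
    (h : IsResolventFamily A (gfun α) (gfun α) (Ioc 0 L) S) : Reg α L S := by
  obtain ⟨Q, h1, _, h2⟩ := res_norm hα0 hL h
  exact ⟨Q, h1, h2⟩

/-- Key lemma: applying `A` to a triple convolution. -/
lemma key_graph {A : X →ₗ.[ℂ] X} (hA : IsClosed (A.graph : Set (X × X))) {α b c d s : ℝ} (hα0 : 0 < α)
    (hb : 0 < b) (hc : 0 < c) (hd : 0 < d) (hs : 0 < s) {G : ℝ → X →L[ℂ] X} {u z : ℝ → X}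
    (hG : Reg b s G) (hu : RegV c s u) (hz : RegV d s z)
    (hGA : ∀ σ ∈ Ioo 0 s, ∀ x y, (x, y) ∈ A.graph → (G σ x, G σ y) ∈ A.graph)
    (huz : ∀ t ∈ Ioo 0 s, (∫ r in (0:ℝ)..t, gfun α (t - r) • u r, z t) ∈ A.graph) :
    (∫ r in (0:ℝ)..s, ∫ σ in (0:ℝ)..(s - r), gfun α (s - σ - r) • G σ (u r),
      ∫ σ in (0:ℝ)..s, G σ (z (s - σ))) ∈ A.graph := by
  obtain ⟨h1, h2, h3, h4⟩ := simplex_fubini _ hs (reg_simplex hα0 hb hc hs hG hu)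
  rw [← h1]
  apply graph_integral hA hs.le h3 (reg_beta hb hd hs hG hz)
  intro σ hσ
  have hsσ : s - σ ∈ Ioo 0 s := ⟨by linarith [hσ.2], by linarith [hσ.1]⟩
  have h5 := hGA σ hσ _ _ (huz (s - σ) hsσ)
  have hi : IntervalIntegrable (fun r => gfun α (s - σ - r) • u r) volume 0 (s - σ) := by
    have hu' := hu.mono hsσ.2.le
    have hg : Reg α (s - σ) (fun t => gfun α t • ContinuousLinearMap.id ℂ X) := by
      refine ⟨fun _ => (Real.Gamma α)⁻¹ • ContinuousLinearMap.id ℂ X, ⟨fun x => continuous_const, _, fun t => le_rfl⟩, ?_⟩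
      intro t ht
      simp only [gfun, smul_smul, div_eq_mul_inv]
    have h6 := (reg_beta hα0 hc hsσ.1 hg hu').comp_sub_left (s - σ)
    simp only [sub_zero, sub_self] at h6
    exact ii_integrable_congr hsσ.1.le h6.symm (fun x _ => by rw [_root_.sub_sub_cancel]; rfl)
  have e : ∫ r in (0:ℝ)..(s - σ), gfun α (s - σ - r) • G σ (u r) =
      G σ (∫ r in (0:ℝ)..(s - σ), gfun α (s - σ - r) • u r) := by
    rw [← ContinuousLinearMap.intervalIntegral_comp_comm _ hi]
    apply ii_congr hsσ.1.le
    intro r hr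
    rw [ContinuousLinearMap.map_smul_of_tower]
  rw [e]
  exact h5

lemma res_unique {A : X →ₗ.[ℂ] X} (hA : IsClosed (A.graph : Set (X × X))) {α L : ℝ} (hα0 : 0 < α)
    (hL : 0 < L) {S S' : ℝ → X →L[ℂ] X}
    (h : IsResolventFamily A (gfun α) (gfun α) (Ioc 0 L) S)
    (h' : IsResolventFamily A (gfun α) (gfun α) (Ioc 0 L) S') :
    ∀ t ∈ Ioc 0 L, S t = S' t := by
  have hS := res_reg hα0 hL h
  have hS' := res_reg hα0 hL h'
  intro t ht
  ext x
  set v : ℝ → X := fun r => S r x - S' r x with hv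
  have hvR : RegV α L v := (hS.regV x).sub (hS'.regV x)
  have hconv_int : ∀ {G : ℝ → X →L[ℂ] X}, Reg α L G → ∀ s ∈ Ioc 0 L, ∀ x : X,
      IntervalIntegrable (fun r => gfun α (s - r) • G r x) volume 0 s := by
    intro G hG s hs x
    have hR := (reg_beta hα0 hα0 hs.1 (hG.mono hs.2) (regV_gfun α s x))
    exact ii_integrable_congr hs.1.le hR (fun r _ => by rw [ContinuousLinearMap.map_smul_of_tower])
  have hvA : ∀ s ∈ Ioc 0 L, (∫ r in (0:ℝ)..s, gfun α (s - r) • v r, v s) ∈ A.graph := by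
    intro s hs
    have h1 := A.graph.sub_mem (res_conv h hs x) (res_conv h' hs x)
    convert h1 using 1
    simp only [Prod.mk_sub_mk, hv, sub_sub_sub_cancel_right]
    congr 1
    unfold convOp
    rw [← intervalIntegral.integral_sub (hconv_int hS s hs x) (hconv_int hS' s hs x)]
    simp only [smul_sub]
  have hzero : ∀ s ∈ Ioc 0 L, ∫ r in (0:ℝ)..s, gfun α (s - r) • v r = 0 := by
    intro s hs
    have hSs := hS.mono hs.2
    have hvs := hvR.mono hs.2
    have h1 := key_graph hA hα0 hα0 hα0 hα0 hs.1 hSs hvs hvs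
      (fun σ hσ x y hxy => res_comm h ⟨hσ.1, hσ.2.le.trans hs.2⟩ hxy)
      (fun t ht => hvA t ⟨ht.1, ht.2.le.trans hs.2⟩)
    have h4 := (simplex_fubini _ hs.1 (reg_simplex hα0 hα0 hα0 hs.1 hSs hvs)).2.2.2
    have hi1 : IntervalIntegrable (fun r => S (s - r) (v r)) volume 0 s := by
      have h6 := (reg_beta hα0 hα0 hs.1 hSs hvs).comp_sub_left s
      simp only [sub_zero, sub_self] at h6
      exact ii_integrable_congr hs.1.le h6.symm (fun x _ => by rw [_root_.sub_sub_cancel])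
    have hi2 : IntervalIntegrable (fun r => gfun α (s - r) • v r) volume 0 s := by
      have a1 := hconv_int hS s hs x
      have a2 := hconv_int hS' s hs x
      exact ii_integrable_congr hs.1.le (a1.sub a2) (fun r _ => by simp [hv, smul_sub])
    have h2 := graph_integral hA hs.1.le h4 (hi1.sub hi2) (fun r hr => by
      have h5 := res_conv h (t := s - r) ⟨by linarith [hr.2], by linarith [hr.1, hs.2]⟩ (v r)
      unfold convOp at h5
      simp_rw [show ∀ σ, s - σ - r = s - r - σ by intro σ; ring]
      exact h5)
    rw [intervalIntegral.integral_sub hi1 hi2] at h2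
    have h3 := A.graph.sub_mem h1 h2
    have e : ∫ σ in (0:ℝ)..s, S σ (v (s - σ)) = ∫ r in (0:ℝ)..s, S (s - r) (v r) := by
      have := intervalIntegral.integral_comp_sub_left (a := 0) (b := s) (fun r => S (s - r) (v r)) s
      simpa using this
    rw [e] at h3
    simp only [Prod.mk_sub_mk, _root_.sub_sub_cancel, sub_self] at h3
    exact LinearPMap.graph_fst_eq_zero_snd A h3 rfl
  have h1 := hvA t ht
  rw [hzero t ht] at h1
  have := LinearPMap.graph_fst_eq_zero_snd A h1 rfl
  exact sub_eq_zero.1 this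


lemma clm_of_integral {Ω : Type*} [MeasurableSpace Ω] (μ : Measure Ω) (B : Ω → X →L[ℂ] X)
    (hm : ∀ x, AEStronglyMeasurable (fun ω => B ω x) μ) {b : Ω → ℝ} (hb : Integrable b μ)
    (hB : ∀ᵐ ω ∂μ, ‖B ω‖ ≤ b ω) : ∃ W : X →L[ℂ] X, ∀ x, W x = ∫ ω, B ω x ∂μ := by
  have hi : ∀ x, Integrable (fun ω => B ω x) μ := by
    intro x
    refine Integrable.mono' (hb.mul_const ‖x‖) (hm x) ?_
    filter_upwards [hB] with ω hω
    exact (B ω).le_of_opNorm_le hω x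
  let W0 : X →ₗ[ℂ] X :=
    { toFun := fun x => ∫ ω, B ω x ∂μ
      map_add' := fun x y => by simp only [map_add]; exact integral_add (hi x) (hi y)
      map_smul' := fun c x => by simp only [map_smul, RingHom.id_apply]; exact integral_smul c _ }
  refine ⟨W0.mkContinuous (∫ ω, b ω ∂μ) ?_, fun x => rfl⟩
  intro x
  have : ‖∫ ω, B ω x ∂μ‖ ≤ ∫ ω, b ω * ‖x‖ ∂μ := by
    apply norm_integral_le_of_norm_le (hb.mul_const ‖x‖)
    filter_upwards [hB] with ω hω
    exact (B ω).le_of_opNorm_le hω x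
  rw [integral_mul_const] at this
  exact this

lemma peak_limit {α N : ℝ} (hα0 : 0 < α) (hN : 0 < N) {g : ℝ → X}
    (hg : IntegrableOn g (Ioc 0 N)) (hgc : ContinuousWithinAt g (Ioc 0 N) N) :
    Tendsto (fun σ : ℝ => ∫ r in Ioc 0 N, (α * σ ^ α * (N + σ - r) ^ (-1 - α)) • g r) (𝓝[>] 0) (𝓝 (g N)) := by
  have hσα : Tendsto (fun σ : ℝ => σ ^ α) (𝓝[>] 0) (𝓝 0) := by
    have := (Real.continuousAt_rpow_const 0 α (Or.inr hα0.le)).tendsto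
    rw [Real.zero_rpow hα0.ne'] at this
    exact this.mono_left nhdsWithin_le_nhds
  refine tendsto_setIntegral_peak_smul_of_integrableOn_of_tendsto measurableSet_Ioc measurableSet_Ioc
    (subset_refl _) self_mem_nhdsWithin (by simp) ?_ ?_ ?_ ?_ hg hgc
  · filter_upwards [self_mem_nhdsWithin] with σ hσ r hr
    have h1 : 0 < σ := hσ
    have h2 : 0 < N + σ - r := by linarith [hr.2]
    positivity
  · intro u hu hNu
    obtain ⟨δ, hδ, hδu⟩ := Metric.isOpen_iff.1 hu N hNu
    rw [Metric.tendstoUniformlyOn_iff]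
    intro ε hε
    have h1 : Tendsto (fun σ : ℝ => α * σ ^ α * δ ^ (-1 - α)) (𝓝[>] 0) (𝓝 0) := by
      simpa using (hσα.const_mul α).mul_const (δ ^ (-1 - α))
    filter_upwards [h1.eventually (gt_mem_nhds hε), self_mem_nhdsWithin] with σ hσ1 hσ r hr
    have hσ0 : 0 < σ := hσ
    have hr2 : δ ≤ N - r := by
      by_contra hlt
      apply hr.2
      apply hδu
      rw [Metric.mem_ball, dist_comm, Real.dist_eq, abs_of_nonneg (by linarith [hr.1.2])]
      linarith
    have h2 : 0 < N + σ - r := by linarith [hr.1.2]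
    simp only [Pi.zero_apply, dist_zero_left]
    rw [Real.norm_of_nonneg (by positivity)]
    refine lt_of_le_of_lt ?_ hσ1
    gcongr α * σ ^ α * ?_
    exact Real.rpow_le_rpow_of_nonpos hδ (by linarith) (by linarith)
  · have e : ∀ σ ∈ Ioi (0:ℝ), ∫ r in Ioc 0 N, α * σ ^ α * (N + σ - r) ^ (-1 - α) = 1 - σ ^ α * (N + σ) ^ (-α) := by
      intro σ hσ
      have hσ0 : 0 < σ := hσ
      rw [← intervalIntegral.integral_of_le hN.le,
        intervalIntegral.integral_eq_sub_of_hasDerivAt (f := fun r => σ ^ α * (N + σ - r) ^ (-α))]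
      · rw [show N + σ - N = σ by ring, ← Real.rpow_add hσ0]
        simp
      · intro r hr
        rw [uIcc_of_le hN.le] at hr
        have h2 : 0 < N + σ - r := by linarith [hr.2]
        have hd : HasDerivAt (fun r : ℝ => N + σ - r) (-1) r := by
          simpa using (hasDerivAt_id r).const_sub (N + σ)
        refine ((hd.rpow_const (p := -α) (Or.inl h2.ne')).const_mul (σ ^ α)).congr_deriv ?_
        rw [show -α - 1 = -1 - α by ring]
        ring
      · apply ContinuousOn.intervalIntegrable
        intro r hr
        rw [uIcc_of_le hN.le] at hr
        have h2 : 0 < N + σ - r := by linarith [hr.2]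
        apply ContinuousAt.continuousWithinAt
        exact continuousAt_const.mul (ContinuousAt.rpow_const (by fun_prop) (Or.inl h2.ne'))
    have h1 : Tendsto (fun σ : ℝ => 1 - σ ^ α * (N + σ) ^ (-α)) (𝓝[>] 0) (𝓝 1) := by
      have h2 : Tendsto (fun σ : ℝ => (N + σ) ^ (-α)) (𝓝[>] 0) (𝓝 ((N + 0) ^ (-α))) := by
        have : ContinuousAt (fun σ : ℝ => (N + σ) ^ (-α)) 0 :=
          ContinuousAt.rpow_const (by fun_prop) (Or.inl (by linarith))
        exact this.tendsto.mono_left nhdsWithin_le_nhds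
      simpa using (hσα.mul h2).const_sub 1
    refine h1.congr' ?_
    filter_upwards [self_mem_nhdsWithin] with σ hσ
    exact (e σ hσ).symm
  · refine Eventually.of_forall fun σ => ?_
    have : Measurable (fun r : ℝ => α * σ ^ α * (N + σ - r) ^ (-1 - α)) := by fun_prop
    exact this.aestronglyMeasurable

lemma F_exists {α N T : ℝ} (hα0 : 0 < α) (hα1 : α < 1) (hN : 0 < N) (hT : 0 < T) {S : ℝ → X →L[ℂ] X}
    (hS : Reg α N S) (hSc : ∀ x, ContinuousOn (fun t => S t x) (Ioc 0 N)) :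
    ∃ F : ℝ → X →L[ℂ] X,
      (∀ σ, 0 < σ → ∀ y, F σ y = (α / Real.Gamma (1 - α)) • ∫ r in (0:ℝ)..N, (N + σ - r) ^ (-1 - α) • S r y) ∧
      ∃ Q : ℝ → X →L[ℂ] X, SC Q ∧ Q 0 = (Real.Gamma (1 - α))⁻¹ • S N ∧
        ∀ σ ∈ Ioc 0 T, F σ = σ ^ ((1 - α) - 1) • Q σ := by
  have hΓ := Real.Gamma_pos_of_pos (show 0 < 1 - α by linarith)
  have hSi : ∀ y, IntervalIntegrable (fun r => S r y) volume 0 N := fun y => (hS.regV y).integrable hα0 hN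
  have hSi' : ∀ y, IntegrableOn (fun r => S r y) (Ioc 0 N) := fun y => by
    rw [← intervalIntegrable_iff_integrableOn_Ioc_of_le hN.le]; exact hSi y
  have hbd : ∃ C, ∀ r ∈ Ioc 0 N, ‖S r‖ ≤ r ^ (α - 1) * C := by
    obtain ⟨Q, ⟨_, C, hC⟩, h⟩ := hS
    refine ⟨C, fun r hr => ?_⟩
    rw [h r hr, norm_smul, Real.norm_of_nonneg (Real.rpow_nonneg hr.1.le _)]
    have := Real.rpow_nonneg hr.1.le (α - 1)
    gcongr
    exact hC r
  obtain ⟨C, hC⟩ := hbd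
  have hcontk : ∀ σ, 0 < σ → ContinuousOn (fun r : ℝ => (N + σ - r) ^ (-1 - α)) (uIcc 0 N) := by
    intro σ hσ r hr
    rw [uIcc_of_le hN.le] at hr
    have h2 : 0 < N + σ - r := by linarith [hr.2]
    exact (ContinuousAt.rpow_const (by fun_prop) (Or.inl h2.ne')).continuousWithinAt
  have hex : ∀ σ : ℝ, ∃ W : X →L[ℂ] X, 0 < σ → ∀ y, W y = ∫ r in (0:ℝ)..N, (N + σ - r) ^ (-1 - α) • S r y := by
    intro σ
    by_cases hσ : 0 < σ
    · have hb : IntervalIntegrable (fun r : ℝ => r ^ (α - 1) * C * (N + σ - r) ^ (-1 - α)) volume 0 N := by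
        apply IntervalIntegrable.mul_continuousOn _ (hcontk σ hσ)
        apply IntervalIntegrable.mul_const
        simpa using (beta_int hα0 one_pos hN).1
      rw [intervalIntegrable_iff_integrableOn_Ioc_of_le hN.le] at hb
      have hm1 : ∀ y, AEStronglyMeasurable (fun r => ((N + σ - r) ^ (-1 - α) • S r) y) (volume.restrict (Ioc 0 N)) := by
        intro y
        have : Measurable (fun r : ℝ => (N + σ - r) ^ (-1 - α)) := by fun_prop
        exact this.aestronglyMeasurable.smul (hSi' y).aestronglyMeasurable
      have hm2 : ∀ᵐ r ∂(volume.restrict (Ioc 0 N)), ‖(N + σ - r) ^ (-1 - α) • S r‖ ≤ r ^ (α - 1) * C * (N + σ - r) ^ (-1 - α) := by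
        refine (ae_restrict_iff' measurableSet_Ioc).2 (Eventually.of_forall fun r hr => ?_)
        have h2 : 0 < N + σ - r := by linarith [hr.2]
        rw [norm_smul, Real.norm_of_nonneg (by positivity), mul_comm]
        gcongr
        exact hC r hr
      obtain ⟨W, hW⟩ := clm_of_integral (volume.restrict (Ioc 0 N)) (fun r => (N + σ - r) ^ (-1 - α) • S r) hm1 hb hm2
      refine ⟨W, fun _ y => ?_⟩
      rw [hW, intervalIntegral.integral_of_le hN.le]
      rfl
    · exact ⟨0, fun h => absurd h hσ⟩
  choose W hW using hex
  set F : ℝ → X →L[ℂ] X := fun σ => (α / Real.Gamma (1 - α)) • W σ with hF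
  have hF1 : ∀ σ, 0 < σ → ∀ y, F σ y = (α / Real.Gamma (1 - α)) • ∫ r in (0:ℝ)..N, (N + σ - r) ^ (-1 - α) • S r y := by
    intro σ hσ y
    rw [hF, ← hW σ hσ y]; rfl
  refine ⟨F, hF1, ?_⟩
  set E : ℝ → X →L[ℂ] X := fun σ => if σ = 0 then (Real.Gamma (1 - α))⁻¹ • S N else σ ^ α • F σ with hE
  have hpos : ∀ t, t ≠ 0 → E t = t ^ α • F t := fun t ht => by simp [hE, ht]
  have hcont : ∀ x, ContinuousOn (fun t => E t x) (Icc 0 T) := by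
    intro x t ht
    rcases eq_or_lt_of_le ht.1 with h0 | h0
    · subst h0
      have h1 : Tendsto (fun t => E t x) (𝓝[>] 0) (𝓝 (E 0 x)) := by
        have := (peak_limit hα0 hN (hSi' x) (hSc x N ⟨hN, le_rfl⟩)).const_smul (Real.Gamma (1 - α))⁻¹
        have e0 : E 0 x = (Real.Gamma (1 - α))⁻¹ • S N x := by simp [hE]
        rw [e0]
        refine this.congr' ?_
        filter_upwards [self_mem_nhdsWithin] with t ht
        have ht' : 0 < t := ht
        rw [hpos t ht'.ne', _root_.smul_apply, hF1 t ht', intervalIntegral.integral_of_le hN.le, smul_smul,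
          ← integral_smul, ← integral_smul]
        congr 1
        funext r
        rw [smul_smul, smul_smul]
        congr 1
        ring
      have h2 : ContinuousWithinAt (fun t => E t x) (insert 0 (Ioi 0)) 0 :=
        continuousWithinAt_insert_self.2 h1
      refine h2.mono ?_
      intro y hy
      rcases eq_or_lt_of_le hy.1 with h | h
      · left; exact h.symm
      · right; exact h
    · apply ContinuousAt.continuousWithinAt
      have h3 : ContinuousAt (fun σ : ℝ => ∫ r in (0:ℝ)..N, (N + σ - r) ^ (-1 - α) • S r x) t := by
        apply intervalIntegral.continuousAt_of_dominated_interval (bound := fun r => (t / 2) ^ (-1 - α) * ‖S r x‖)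
        · refine Eventually.of_forall fun σ => ?_
          rw [uIoc_of_le hN.le]
          have : Measurable (fun r : ℝ => (N + σ - r) ^ (-1 - α)) := by fun_prop
          exact this.aestronglyMeasurable.smul (hSi' x).aestronglyMeasurable
        · filter_upwards [lt_mem_nhds (show t / 2 < t by linarith)] with σ hσ
          refine Eventually.of_forall fun r hr => ?_
          rw [uIoc_of_le hN.le] at hr
          have h4 : t / 2 ≤ N + σ - r := by linarith [hr.2]
          have h5 : 0 < N + σ - r := by linarith
          rw [norm_smul, Real.norm_of_nonneg (by positivity)]
          have hh := Real.rpow_le_rpow_of_nonpos (show 0 < t / 2 by linarith) h4 (show (-1 - α) ≤ 0 by linarith)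
          exact mul_le_mul_of_nonneg_right hh (norm_nonneg _)
        · exact (hSi x).norm.const_mul _
        · refine Eventually.of_forall fun r hr => ?_
          rw [uIoc_of_le hN.le] at hr
          have h5 : 0 < N + t - r := by linarith [hr.2]
          have h6 : ContinuousAt (fun y : ℝ => (N + y - r) ^ (-1 - α)) t :=
            ContinuousAt.rpow_const (by fun_prop) (Or.inl h5.ne')
          exact h6.smul continuousAt_const
      have h4 : ContinuousAt (fun σ : ℝ => σ ^ α • ((α / Real.Gamma (1 - α)) • ∫ r in (0:ℝ)..N, (N + σ - r) ^ (-1 - α) • S r x)) t :=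
        (Real.continuousAt_rpow_const t _ (Or.inl h0.ne')).smul (h3.const_smul _)
      refine h4.congr ?_
      filter_upwards [lt_mem_nhds h0] with σ hσ
      rw [hpos σ hσ.ne', _root_.smul_apply, hF1 σ hσ]
  obtain ⟨Q, hQ, hQE⟩ := sc_extend hT.le E hcont
  refine ⟨Q, hQ, ?_, ?_⟩
  · rw [hQE 0 ⟨le_rfl, hT.le⟩]; simp [hE]
  · intro t ht
    rw [hQE t ⟨ht.1.le, ht.2⟩, hpos t ht.1.ne', smul_smul, ← Real.rpow_add ht.1]
    simp


/-- The continuation operators. -/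
lemma w_exists {α T : ℝ} (hα0 : 0 < α) (hα1 : α < 1) {F S1 P Q : ℝ → X →L[ℂ] X} {SN : X →L[ℂ] X}
    (hQ : SC Q) (hP : SC P) (hQ0 : Q 0 = (Real.Gamma (1 - α))⁻¹ • SN)
    (hP0 : P 0 = (Real.Gamma α)⁻¹ • ContinuousLinearMap.id ℂ X)
    (hF : ∀ σ ∈ Ioc 0 T, F σ = σ ^ ((1 - α) - 1) • Q σ)
    (hS1 : ∀ t ∈ Ioc 0 T, S1 t = t ^ (α - 1) • P t) :
    ∃ w : ℝ → X →L[ℂ] X, (∀ x, Continuous fun s => w s x) ∧ (w 0 = SN) ∧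
      ∀ s ∈ Ioc 0 T, ∀ x, w s x = ∫ r in (0:ℝ)..s, F (s - r) (S1 r x) := by
  have hΓ := Real.Gamma_pos_of_pos (show 0 < 1 - α by linarith)
  have hΓ' := Real.Gamma_pos_of_pos hα0
  obtain ⟨hb1, hb2⟩ := beta_aux hα0 (show 0 < 1 - α by linarith)
  have hbv : ProbabilityTheory.beta α (1 - α) = Real.Gamma α * Real.Gamma (1 - α) := by
    simp [ProbabilityTheory.beta]
  obtain ⟨_, C, hC⟩ := id hQ
  obtain ⟨_, D, hD⟩ := id hP
  set k : ℝ → ℝ := fun ρ => ρ ^ (α - 1) * (1 - ρ) ^ ((1 - α) - 1) with hk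
  have hkm : Measurable k := by fun_prop
  have hk0 : ∀ ρ ∈ Ioc (0:ℝ) 1, 0 ≤ k ρ := fun ρ hρ =>
    mul_nonneg (Real.rpow_nonneg hρ.1.le _) (Real.rpow_nonneg (by linarith [hρ.2]) _)
  have hb := hb1.mul_const (C * D)
  have hb' := hb
  rw [intervalIntegrable_iff_integrableOn_Ioc_of_le zero_le_one] at hb'
  have hm1 : ∀ s : ℝ, ∀ x, AEStronglyMeasurable (fun ρ => (k ρ • (Q (s * (1 - ρ)) ∘L P (s * ρ))) x) (volume.restrict (Ioc 0 1)) := by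
    intro s x
    have hc1 : Continuous fun ρ : ℝ => P (s * ρ) x := hP.comp (by fun_prop) continuous_const
    have hc2 : Continuous fun ρ : ℝ => Q (s * (1 - ρ)) (P (s * ρ) x) := hQ.comp (by fun_prop) hc1
    exact hkm.aestronglyMeasurable.smul hc2.aestronglyMeasurable
  have hbd : ∀ s : ℝ, ∀ ρ ∈ Ioc (0:ℝ) 1, ‖k ρ • (Q (s * (1 - ρ)) ∘L P (s * ρ))‖ ≤ k ρ * (C * D) := by
    intro s ρ hρ
    rw [norm_smul, Real.norm_of_nonneg (hk0 ρ hρ)]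
    refine mul_le_mul_of_nonneg_left ?_ (hk0 ρ hρ)
    refine (ContinuousLinearMap.opNorm_comp_le _ _).trans ?_
    exact mul_le_mul (hC _) (hD _) (norm_nonneg _) ((norm_nonneg _).trans (hC 0))
  have hex : ∀ s : ℝ, ∃ W : X →L[ℂ] X, ∀ x, W x = ∫ ρ in (0:ℝ)..1, k ρ • Q (s * (1 - ρ)) (P (s * ρ) x) := by
    intro s
    obtain ⟨W, hW⟩ := clm_of_integral (volume.restrict (Ioc 0 1)) (fun ρ => k ρ • (Q (s * (1 - ρ)) ∘L P (s * ρ))) (hm1 s) hb'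
      ((ae_restrict_iff' measurableSet_Ioc).2 (Eventually.of_forall fun ρ hρ => hbd s ρ hρ))
    refine ⟨W, fun x => ?_⟩
    rw [hW, intervalIntegral.integral_of_le zero_le_one]
    rfl
  choose w hw using hex
  refine ⟨w, ?_, ?_, ?_⟩
  · intro x
    simp_rw [hw]
    refine intervalIntegral.continuous_of_dominated_interval (bound := fun ρ => k ρ * (C * D) * ‖x‖) ?_ ?_ (hb.mul_const _) ?_
    · intro s
      rw [uIoc_of_le zero_le_one]
      exact hm1 s x
    · intro s
      refine Eventually.of_forall fun ρ hρ => ?_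
      rw [uIoc_of_le zero_le_one] at hρ
      exact ContinuousLinearMap.le_of_opNorm_le _ (hbd s ρ hρ) x
    · refine Eventually.of_forall fun ρ hρ => ?_
      have hc1 : Continuous fun s : ℝ => P (s * ρ) x := hP.comp (by fun_prop) continuous_const
      have hc2 : Continuous fun s : ℝ => Q (s * (1 - ρ)) (P (s * ρ) x) := hQ.comp (by fun_prop) hc1
      exact continuous_const.smul hc2
  · ext x
    rw [hw]
    simp only [zero_mul, hQ0, hP0]
    rw [intervalIntegral.integral_smul_const, hb2, hbv]
    simp only [_root_.smul_apply, ContinuousLinearMap.map_smul_of_tower, smul_smul, ContinuousLinearMap.id_apply]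
    rw [show Real.Gamma α * Real.Gamma (1 - α) * ((Real.Gamma (1 - α))⁻¹ * (Real.Gamma α)⁻¹) = 1 by field_simp, one_smul]
  · intro s hs x
    have h1 := intervalIntegral.integral_comp_mul_left (a := 0) (b := 1) (fun r => F (s - r) (S1 r x)) hs.1.ne'
    rw [mul_zero, mul_one] at h1
    have h2 : ∫ r in (0:ℝ)..s, F (s - r) (S1 r x) = s • ∫ ρ in (0:ℝ)..1, F (s - s * ρ) (S1 (s * ρ) x) := by
      rw [h1, smul_smul, mul_inv_cancel₀ hs.1.ne', one_smul]
    rw [h2, hw, ← intervalIntegral.integral_smul]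
    apply ii_congr zero_le_one
    intro ρ hρ
    have hs0 := hs.1
    have h3 : 0 < 1 - ρ := by linarith [hρ.2]
    have h4 := hρ.1
    have e : s - s * ρ = s * (1 - ρ) := by ring
    have hle : s * ρ ≤ T := by nlinarith [hs.2, hρ.2]
    have hle2 : s * (1 - ρ) ≤ T := by nlinarith [hs.2]
    rw [e, hF _ ⟨by positivity, hle2⟩, hS1 _ ⟨by positivity, hle⟩]
    simp only [_root_.smul_apply, ContinuousLinearMap.map_smul_of_tower, smul_smul]
    congr 1
    rw [hk, Real.mul_rpow hs0.le h3.le, Real.mul_rpow hs0.le h4.le]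
    have : s * (s ^ (1 - α - 1) * s ^ (α - 1)) = 1 := by
      rw [← Real.rpow_add hs0]
      nth_rewrite 1 [← Real.rpow_one s]
      rw [← Real.rpow_add hs0]
      ring_nf
      exact Real.rpow_zero s
    linear_combination (-(ρ ^ (α - 1) * (1 - ρ) ^ (1 - α - 1))) * this

lemma reg_integrable' {b c s : ℝ} (hb : 0 < b) (hc : 0 < c) (hs : 0 < s)
    {G : ℝ → X →L[ℂ] X} {u : ℝ → X} (hG : Reg b s G) (hu : RegV c s u) :
    IntervalIntegrable (fun r : ℝ => G (s - r) (u r)) volume 0 s := by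
  have h6 := (reg_beta hb hc hs hG hu).comp_sub_left s
  simp only [sub_zero, sub_self] at h6
  exact ii_integrable_congr hs.le h6.symm (fun x _ => by rw [_root_.sub_sub_cancel])

/-- the auxiliary kernel -/
def kker (α s q : ℝ) : ℝ := q ^ (-α) * (s ^ α / (s + max q 0)) / (Real.Gamma α * Real.Gamma (1 - α))

lemma kker_reg {α s L : ℝ} (hs : 0 < s) :
    Reg (1 - α) L (fun q => kker α s q • ContinuousLinearMap.id ℂ X) := by
  set f : ℝ → ℝ := fun q => (s ^ α / (s + max q 0)) / (Real.Gamma α * Real.Gamma (1 - α)) with hf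
  have hfc : Continuous f := by
    apply Continuous.div_const
    apply Continuous.div continuous_const (by fun_prop)
    intro q
    have := le_max_right q 0
    positivity
  have hfb : ∀ q, ‖f q‖ ≤ (s ^ α / s) / |Real.Gamma α * Real.Gamma (1 - α)| := by
    intro q
    have := le_max_right q 0
    rw [hf]
    simp only
    rw [norm_div, Real.norm_of_nonneg (by positivity), Real.norm_eq_abs]
    gcongr
    linarith
  refine ⟨fun q => f q • ContinuousLinearMap.id ℂ X, ⟨fun x => hfc.smul continuous_const, ?_⟩, ?_⟩
  · refine ⟨(s ^ α / s) / |Real.Gamma α * Real.Gamma (1 - α)| * ‖ContinuousLinearMap.id ℂ X‖, fun t => ?_⟩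
    rw [norm_smul]
    gcongr
    exact hfb t
  · intro t ht
    simp only [kker, hf, smul_smul]
    rw [show 1 - α - 1 = -α by ring]
    congr 1
    ring

lemma kker1 {α s q : ℝ} (hα0 : 0 < α) (hs : 0 < s) (hq : 0 < q) :
    ∫ σ in (0:ℝ)..s, gfun α (s - σ) * (α / Real.Gamma (1 - α) * (σ + q) ^ (-1 - α)) = kker α s q := by
  have h := (kernel1 hα0 hs hq).2
  have e : ∀ σ : ℝ, gfun α (s - σ) * (α / Real.Gamma (1 - α) * (σ + q) ^ (-1 - α)) =
      (α / Real.Gamma (1 - α) / Real.Gamma α) * ((s - σ) ^ (α - 1) * (σ + q) ^ (-1 - α)) := by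
    intro σ
    rw [gfun]; ring
  simp_rw [e]
  rw [intervalIntegral.integral_const_mul, h, kker, max_eq_left hq.le, Real.div_rpow hs.le hq.le, Real.rpow_neg hq.le]
  have := (Real.rpow_pos_of_pos hq α).ne'
  field_simp

lemma kker2 {α s p : ℝ} (hα0 : 0 < α) (hα1 : α < 1) (hs : 0 < s) (hp : 0 < p) :
    ∫ q in (0:ℝ)..p, gfun α (p - q) * kker α s q = gfun α (p + s) := by
  have hΓ := Real.Gamma_pos_of_pos (show 0 < 1 - α by linarith)
  have hΓ' := Real.Gamma_pos_of_pos hα0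
  have h := kernel2 hα0 hα1 hs hp
  rw [ii_congr hp.le (g := fun q => (Real.Gamma α * Real.Gamma (1 - α) * Real.Gamma α)⁻¹ * ((p - q) ^ (α - 1) * (q ^ (-α) * (s ^ α / (s + q)))))]
  · rw [intervalIntegral.integral_const_mul, h, gfun]
    field_simp
  · intro q hq
    rw [gfun, kker, max_eq_left hq.1.le]
    field_simp


lemma part_one {A : X →ₗ.[ℂ] X} (hA : IsClosed (A.graph : Set (X × X))) {α N s : ℝ} (hα0 : 0 < α)
    (hα1 : α < 1) (hN : 0 < N) (hs : 0 < s) {S : ℝ → X →L[ℂ] X}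
    (h : IsResolventFamily A (gfun α) (gfun α) (Ioc 0 N) S) (x : X) :
    (∫ r in (0:ℝ)..N, gfun α (N + s - r) • S r x,
      (∫ r in (0:ℝ)..N, kker α s (N - r) • S r x) - gfun α (N + s) • x) ∈ A.graph := by
  have hS := res_reg hα0 hN h
  have hb : 0 < 1 - α := by linarith
  have hK : Reg (1 - α) N (fun q => kker α s q • ContinuousLinearMap.id ℂ X) := kker_reg hs
  have hg := regV_gfun α N x
  have h1 := key_graph hA hα0 hb hα0 hα0 hN hK (hS.regV x) ((hS.regV x).sub hg)
    (fun σ _ x y hxy => by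
      have := Submodule.smul_of_tower_mem A.graph (kker α s σ) hxy
      exact this)
    (fun t ht => res_conv h ⟨ht.1, ht.2.le⟩ x)
  convert h1 using 1
  congr 1
  · apply ii_congr hN.le
    intro r hr
    have e := kker2 hα0 hα1 hs (sub_pos.2 hr.2)
    rw [show N - r + s = N + s - r by ring] at e
    rw [← e, ← intervalIntegral.integral_smul_const]
    apply ii_congr (by linarith [hr.2])
    intro q hq
    simp only [_root_.smul_apply, ContinuousLinearMap.id_apply, smul_smul]
    rw [show N - q - r = N - r - q by ring]
  · have i1 := reg_beta hb hα0 hN hK (hS.regV x)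
    have i2 := reg_beta hb hα0 hN hK hg
    have e1 : ∀ σ, (kker α s σ • ContinuousLinearMap.id ℂ X) (S (N - σ) x - gfun α (N - σ) • x) =
      (kker α s σ • ContinuousLinearMap.id ℂ X) (S (N - σ) x) - (kker α s σ • ContinuousLinearMap.id ℂ X) (gfun α (N - σ) • x) :=
      fun σ => map_sub _ _ _
    simp_rw [e1]
    rw [intervalIntegral.integral_sub i1 i2]
    congr 1
    · have := intervalIntegral.integral_comp_sub_left (a := 0) (b := N) (fun r => kker α s (N - r) • S r x) N
      simp only [sub_zero, sub_self, _root_.sub_sub_cancel] at this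
      rw [← this]
      rfl
    · rw [← kker2 hα0 hα1 hs hN, ← intervalIntegral.integral_smul_const]
      apply ii_congr hN.le
      intro q hq
      simp only [_root_.smul_apply, ContinuousLinearMap.id_apply, smul_smul]
      rw [mul_comm]

lemma part_three {α N s : ℝ} (hα0 : 0 < α) (hα1 : α < 1) (hN : 0 < N) (hs : 0 < s)
    {S F : ℝ → X →L[ℂ] X} (hS : Reg α N S)
    (hF : ∀ σ, 0 < σ → ∀ y, F σ y = (α / Real.Gamma (1 - α)) • ∫ r in (0:ℝ)..N, (N + σ - r) ^ (-1 - α) • S r y)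
    (x : X) :
    ∫ σ in (0:ℝ)..s, F σ (gfun α (s - σ) • x) = ∫ r in (0:ℝ)..N, kker α s (N - r) • S r x := by
  have hb : 0 < 1 - α := by linarith
  have hΓ := Real.Gamma_pos_of_pos hb
  have hΓ' := Real.Gamma_pos_of_pos hα0
  set k : ℝ → ℝ → ℝ := fun σ r => gfun α (s - σ) * (α / Real.Gamma (1 - α) * (σ + (N - r)) ^ (-1 - α)) with hk
  have hk0 : ∀ σ ∈ Ioo 0 s, ∀ r ∈ Ioo 0 N, 0 ≤ k σ r := by
    intro σ hσ r hr
    have h1 : 0 < s - σ := by linarith [hσ.2]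
    have h2 : 0 < σ + (N - r) := by linarith [hσ.1, hr.2]
    simp only [hk, gfun]
    positivity
  have e1 : ∫ σ in (0:ℝ)..s, F σ (gfun α (s - σ) • x) = ∫ σ in Ioo 0 s, ∫ r in Ioo 0 N, k σ r • S r x := by
    rw [intervalIntegral.integral_of_le hs.le, integral_Ioc_eq_integral_Ioo]
    apply setIntegral_congr_fun measurableSet_Ioo
    intro σ hσ
    simp only
    rw [ContinuousLinearMap.map_smul_of_tower, hF σ hσ.1, smul_smul, ← intervalIntegral.integral_smul,
      intervalIntegral.integral_of_le hN.le, integral_Ioc_eq_integral_Ioo]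
    congr 1
    funext r
    rw [smul_smul, hk, show N + σ - r = σ + (N - r) by ring]
    simp only [mul_assoc]
  have hinteg : Integrable (fun p : ℝ × ℝ => k p.1 p.2 • S p.2 x)
      ((volume.restrict (Ioo 0 s)).prod (volume.restrict (Ioo 0 N))) := by
    have hSi := (hS.regV x).integrable hα0 hN
    rw [intervalIntegrable_iff_integrableOn_Ioo_of_le hN.le] at hSi
    have hm : Measurable fun p : ℝ × ℝ => k p.1 p.2 := by
      simp only [hk, gfun]
      fun_prop
    have hms : AEStronglyMeasurable (fun p : ℝ × ℝ => k p.1 p.2 • S p.2 x)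
        ((volume.restrict (Ioo 0 s)).prod (volume.restrict (Ioo 0 N))) :=
      hm.aestronglyMeasurable.smul hSi.aestronglyMeasurable.comp_snd
    rw [integrable_prod_iff' hms]
    have hki : ∀ r ∈ Ioo 0 N, IntegrableOn (fun σ => k σ r) (Ioo 0 s) := by
      intro r hr
      have h := (kernel1 hα0 hs (sub_pos.2 hr.2)).1.const_mul (α / Real.Gamma (1 - α) / Real.Gamma α)
      rw [intervalIntegrable_iff_integrableOn_Ioo_of_le hs.le] at h
      refine h.congr (Eventually.of_forall fun σ => ?_)
      simp only [hk, gfun]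
      ring
    constructor
    · rw [ae_restrict_iff' measurableSet_Ioo]
      refine Eventually.of_forall fun r hr => ?_
      exact Integrable.smul_const (f := fun σ => k σ r) (hki r hr) (S r x)
    · have hK : Reg (1 - α) N (fun q => kker α s q • ContinuousLinearMap.id ℂ X) := kker_reg hs
      have h1 := (reg_integrable' hb hα0 hN hK (hS.regV x)).norm
      rw [intervalIntegrable_iff_integrableOn_Ioo_of_le hN.le] at h1
      refine h1.congr ?_
      rw [EventuallyEq, ae_restrict_iff' measurableSet_Ioo]
      refine Eventually.of_forall fun r hr => ?_
      have e2 : ∫ σ in Ioo 0 s, ‖k σ r • S r x‖ = ∫ σ in Ioo 0 s, k σ r * ‖S r x‖ := by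
        apply setIntegral_congr_fun measurableSet_Ioo
        intro σ hσ
        simp only
        rw [norm_smul, Real.norm_of_nonneg (hk0 σ hσ r hr)]
      have e3 := kker1 hα0 hs (sub_pos.2 hr.2)
      rw [intervalIntegral.integral_of_le hs.le, integral_Ioc_eq_integral_Ioo] at e3
      have e4 : 0 ≤ kker α s (N - r) := by
        rw [← e3]
        exact setIntegral_nonneg measurableSet_Ioo fun σ hσ => hk0 σ hσ r hr
      simp only
      rw [e2, integral_mul_const, e3, _root_.smul_apply, norm_smul, Real.norm_of_nonneg e4]
      rfl
  rw [e1, integral_integral_swap hinteg, intervalIntegral.integral_of_le hN.le, integral_Ioc_eq_integral_Ioo]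
  apply setIntegral_congr_fun measurableSet_Ioo
  intro r hr
  simp only
  have e3 := kker1 hα0 hs (sub_pos.2 hr.2)
  rw [intervalIntegral.integral_of_le hs.le, integral_Ioc_eq_integral_Ioo] at e3
  rw [integral_smul_const, e3]


lemma ext_w {A : X →ₗ.[ℂ] X} {α N T : ℝ} (hα0 : 0 < α)
    (hα1 : α < 1) (hN : 0 < N) (hT : 0 < T) {S S1 : ℝ → X →L[ℂ] X}
    (h : IsResolventFamily A (gfun α) (gfun α) (Ioc 0 N) S)
    (h1 : IsResolventFamily A (gfun α) (gfun α) (Ioc 0 T) S1) :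
    ∃ F w : ℝ → X →L[ℂ] X,
      (∀ σ, 0 < σ → ∀ y, F σ y = (α / Real.Gamma (1 - α)) • ∫ r in (0:ℝ)..N, (N + σ - r) ^ (-1 - α) • S r y) ∧
      Reg (1 - α) T F ∧ (∀ x, Continuous fun s => w s x) ∧ (w 0 = S N) ∧
      (∀ s ∈ Ioc 0 T, ∀ x, w s x = ∫ r in (0:ℝ)..s, F (s - r) (S1 r x)) ∧
      (∀ s ∈ Ioc 0 T, ∀ x, w s x = (α / Real.Gamma (1 - α)) • ∫ r₂ in (0:ℝ)..s, ∫ r₁ in (0:ℝ)..N,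
            ((N + s - r₁ - r₂) ^ (-1 - α)) • S r₁ (S1 r₂ x)) := by
  obtain ⟨F, hF, Q, hQ, hQ0, hFQ⟩ := F_exists hα0 hα1 hN hT (res_reg hα0 hN h) h.1
  obtain ⟨P, hP, hP0, hSP⟩ := res_norm hα0 hT h1
  obtain ⟨w, hw1, hw2, hw3⟩ := w_exists hα0 hα1 hQ hP hQ0 hP0 hFQ hSP
  refine ⟨F, w, hF, ⟨Q, hQ, hFQ⟩, hw1, hw2, hw3, ?_⟩
  intro s hs x
  rw [hw3 s hs x, ← intervalIntegral.integral_smul]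
  apply ii_congr hs.1.le
  intro r hr
  rw [hF _ (sub_pos.2 hr.2)]
  congr 2
  funext r₁
  rw [show N + (s - r) - r₁ = N + s - r₁ - r by ring]

lemma ext_core {A : X →ₗ.[ℂ] X} (hA : IsClosed (A.graph : Set (X × X))) {α N T : ℝ} (hα0 : 0 < α)
    (hα1 : α < 1) (hN : 0 < N) {S S1 F w S' : ℝ → X →L[ℂ] X}
    (h : IsResolventFamily A (gfun α) (gfun α) (Ioc 0 N) S)
    (h1 : IsResolventFamily A (gfun α) (gfun α) (Ioc 0 T) S1)
    (hT : 0 < T)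
    (hF : ∀ σ, 0 < σ → ∀ y, F σ y = (α / Real.Gamma (1 - α)) • ∫ r in (0:ℝ)..N, (N + σ - r) ^ (-1 - α) • S r y)
    (hFR : Reg (1 - α) T F) (hwc : ∀ x, Continuous fun s => w s x) (hw0 : w 0 = S N)
    (hw : ∀ s ∈ Ioc 0 T, ∀ x, w s x = ∫ r in (0:ℝ)..s, F (s - r) (S1 r x))
    (hS'1 : ∀ t ∈ Ioc 0 N, S' t = S t) (hS'2 : ∀ t ∈ Ioc N (N + T), S' t = w (t - N)) :
    IsResolventFamily A (gfun α) (gfun α) (Ioc 0 (N + T)) S' := by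
  have hb : 0 < 1 - α := by linarith
  have hS := res_reg hα0 hN h
  have hS1 := res_reg hα0 hT h1
  have hS'2' : ∀ t ∈ Icc N (N + T), S' t = w (t - N) := by
    intro t ht
    rcases eq_or_lt_of_le ht.1 with h0 | h0
    · subst h0
      rw [sub_self, hw0, hS'1 _ ⟨hN, le_rfl⟩]
    · exact hS'2 t ⟨h0, ht.2⟩
  have hFi : ∀ σ, 0 < σ → ∀ y, IntervalIntegrable (fun r => (N + σ - r) ^ (-1 - α) • S r y) volume 0 N := by
    intro σ hσ y
    refine ((hS.regV y).integrable hα0 hN).continuousOn_smul ?_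
    rw [uIcc_of_le hN.le]
    intro r hr
    have : N + σ - r ≠ 0 := by linarith [hr.2]
    exact ((Real.continuousAt_rpow_const _ _ (Or.inl this)).comp (f := fun r => N + σ - r) (by fun_prop)).continuousWithinAt
  have hFA : ∀ σ, 0 < σ → ∀ x y, (x, y) ∈ A.graph → (F σ x, F σ y) ∈ A.graph := by
    intro σ hσ x y hxy
    rw [hF σ hσ, hF σ hσ]
    have := graph_integral hA hN.le (hFi σ hσ x) (hFi σ hσ y) (fun r hr =>
      Submodule.smul_of_tower_mem A.graph ((N + σ - r) ^ (-1 - α)) (res_comm h ⟨hr.1, hr.2.le⟩ hxy))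
    exact Submodule.smul_of_tower_mem A.graph (α / Real.Gamma (1 - α)) this
  refine res_mk ?_ ?_ ?_ ?_
  · intro x
    have c1 : ContinuousOn (fun t => S' t x) (Ioc 0 N) :=
      (h.1 x).congr fun t ht => by simp only [hS'1 t ht]
    have c2 : ContinuousOn (fun t => S' t x) (Icc N (N + T)) := by
      have : Continuous fun t => w (t - N) x := (hwc x).comp (continuous_id.sub continuous_const)
      exact this.continuousOn.congr fun t ht => by simp only [hS'2' t ht]
    intro t ht
    have hsub : Ioc 0 (N + T) = Ioc 0 N ∪ Icc N (N + T) := by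
      ext y
      simp only [mem_Ioc, mem_union, mem_Icc]
      constructor
      · rintro ⟨a, b⟩
        rcases le_total y N with c | c
        · exact Or.inl ⟨a, c⟩
        · exact Or.inr ⟨c, b⟩
      · rintro (⟨a, b⟩ | ⟨a, b⟩)
        · exact ⟨a, by linarith⟩
        · exact ⟨by linarith, b⟩
    rw [hsub, continuousWithinAt_union]
    constructor
    · by_cases hc : t ≤ N
      · exact c1 t ⟨ht.1, hc⟩
      · apply continuousWithinAt_of_notMem_closure
        intro hcl
        have := closure_minimal (Ioc_subset_Icc_self (a := 0) (b := N)) isClosed_Icc hcl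
        exact hc this.2
    · by_cases hc : N ≤ t
      · exact c2 t ⟨hc, ht.2⟩
      · apply continuousWithinAt_of_notMem_closure
        rw [isClosed_Icc.closure_eq]
        intro hcl
        exact hc hcl.1
  · intro x
    exact tendsto_congr_fam hN hS'1 (h.2.1 x)
  · intro t ht x y hxy
    rcases le_or_gt t N with hc | hc
    · rw [hS'1 t ⟨ht.1, hc⟩]
      exact res_comm h ⟨ht.1, hc⟩ hxy
    · have hs : t - N ∈ Ioc 0 T := ⟨by linarith, by linarith [ht.2]⟩
      rw [hS'2 t ⟨hc, ht.2⟩, hw _ hs, hw _ hs]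
      apply graph_integral hA hs.1.le
      · exact reg_integrable' hb hα0 hs.1 (hFR.mono hs.2) ((hS1.regV x).mono hs.2)
      · exact reg_integrable' hb hα0 hs.1 (hFR.mono hs.2) ((hS1.regV y).mono hs.2)
      · intro r hr
        exact hFA _ (sub_pos.2 hr.2) _ _ (res_comm h1 ⟨hr.1, hr.2.le.trans hs.2⟩ hxy)
  · intro t ht x
    rcases le_or_gt t N with hc | hc
    · rw [hS'1 t ⟨ht.1, hc⟩, convOp_congr ht.1.le (fun r hr => hS'1 r ⟨hr.1, hr.2.trans hc⟩)]
      exact res_conv h ⟨ht.1, hc⟩ x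
    · obtain ⟨s, rfl⟩ : ∃ s, t = N + s := ⟨t - N, by ring⟩
      have hs : s ∈ Ioc 0 T := ⟨by linarith, by linarith [ht.2]⟩
      have hF' := hFR.mono hs.2
      have hu := (hS1.regV x).mono hs.2
      have hg := regV_gfun α s x
      rw [hS'2 _ ⟨hc, ht.2⟩, show N + s - N = s by ring]
      have p1 := part_one hA hα0 hα1 hN hs.1 h x
      have p3 := part_three hα0 hα1 hN hs.1 hS hF x
      have p2 := key_graph hA hα0 hb hα0 hα0 hs.1 hF' hu (hu.sub hg)
        (fun σ hσ => hFA σ hσ.1) (fun r hr => res_conv h1 ⟨hr.1, hr.2.le.trans hs.2⟩ x)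
      obtain ⟨_, f2, _, _⟩ := simplex_fubini _ hs.1 (reg_simplex hα0 hb hα0 hs.1 hF' hu)
      rw [← f2] at p2
      have e2 : ∫ q in (0:ℝ)..s, ∫ r in (0:ℝ)..q, gfun α (s - (q - r) - r) • F (q - r) (S1 r x) =
          ∫ q in (0:ℝ)..s, gfun α (s - q) • w q x := by
        apply ii_congr hs.1.le
        intro q hq
        rw [hw q ⟨hq.1, hq.2.le.trans hs.2⟩, ← intervalIntegral.integral_smul]
        congr 1
        funext r
        rw [show s - (q - r) - r = s - q by ring]
      rw [e2] at p2
      have i1 := reg_beta hb hα0 hs.1 hF' hu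
      have i2 := reg_beta hb hα0 hs.1 hF' hg
      have e3 : ∫ σ in (0:ℝ)..s, F σ (S1 (s - σ) x - gfun α (s - σ) • x) =
          w s x - ∫ r in (0:ℝ)..N, kker α s (N - r) • S r x := by
        simp only [map_sub]
        rw [intervalIntegral.integral_sub i1 i2, p3, hw s hs]
        congr 1
        have := intervalIntegral.integral_comp_sub_left (a := 0) (b := s) (fun r => F (s - r) (S1 r x)) s
        simpa using this
      rw [e3] at p2
      have p := A.graph.add_mem p1 p2
      convert p using 1
      rw [Prod.mk_add_mk]
      congr 1
      · unfold convOp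
        have j1 : IntervalIntegrable (fun r => gfun α (N + s - r) • S r x) volume 0 N := by
          refine ((hS.regV x).integrable hα0 hN).continuousOn_smul ?_
          rw [uIcc_of_le hN.le]
          intro r hr
          have hne : N + s - r ≠ 0 := by linarith [hr.2, hs.1]
          exact (((Real.continuousAt_rpow_const _ _ (Or.inl hne)).comp (f := fun r => N + s - r) (by fun_prop)).div_const _).continuousWithinAt
        have j2 : IntervalIntegrable (fun q => gfun α (s - q) • w q x) volume 0 s := by
          have g1 : IntervalIntegrable (fun q => gfun α (s - q)) volume 0 s := by
            have g2 := (beta_int one_pos hα0 hs.1).1.div_const (Real.Gamma α)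
            exact ii_integrable_congr hs.1.le g2 (fun r _ => by simp [gfun])
          exact g1.smul_continuousOn (hwc x).continuousOn
        have k1 : IntervalIntegrable (fun r => gfun α (N + s - r) • S' r x) volume 0 N :=
          ii_integrable_congr hN.le j1 (fun r hr => by rw [hS'1 r ⟨hr.1, hr.2.le⟩])
        have j2' := j2.comp_sub_right N
        have k2 : IntervalIntegrable (fun r => gfun α (N + s - r) • S' r x) volume N (N + s) := by
          rw [zero_add, add_comm s N] at j2'
          refine ii_integrable_congr (by linarith [hs.1]) j2' (fun r hr => ?_)
          rw [hS'2 r ⟨hr.1, by linarith [hr.2, hs.2]⟩, show s - (r - N) = N + s - r by ring]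
        rw [← intervalIntegral.integral_add_adjacent_intervals k1 k2]
        congr 1
        · exact ii_congr hN.le (fun r hr => by rw [hS'1 r ⟨hr.1, hr.2.le⟩])
        · have := intervalIntegral.integral_comp_sub_right (a := N) (b := N + s) (fun q => gfun α (s - q) • w q x) N
          rw [sub_self, add_sub_cancel_left] at this
          rw [← this]
          apply ii_congr (by linarith [hs.1])
          intro r hr
          rw [hS'2 r ⟨hr.1, by linarith [hr.2, hs.2]⟩, show s - (r - N) = N + s - r by ring]
      · abel

lemma ext_main {A : X →ₗ.[ℂ] X} (hA : IsClosed (A.graph : Set (X × X))) {α N T : ℝ} (hα0 : 0 < α)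
    (hα1 : α < 1) (hN : 0 < N) (hT : 0 < T) {S S1 S' : ℝ → X →L[ℂ] X}
    (h : IsResolventFamily A (gfun α) (gfun α) (Ioc 0 N) S)
    (h1 : IsResolventFamily A (gfun α) (gfun α) (Ioc 0 T) S1)
    (hS'1 : ∀ t ∈ Ioc 0 N, S' t = S t)
    (hS'2 : ∀ t ∈ Ioc N (N + T), ∀ x, S' t x = (α / Real.Gamma (1 - α)) •
      ∫ r₂ in (0:ℝ)..(t - N), ∫ r₁ in (0:ℝ)..N, ((t - r₁ - r₂) ^ (-1 - α)) • S r₁ (S1 r₂ x)) :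
    IsResolventFamily A (gfun α) (gfun α) (Ioc 0 (N + T)) S' := by
  obtain ⟨F, w, hF, hFR, hwc, hw0, hw, hw'⟩ := ext_w hα0 hα1 hN hT h h1
  refine ext_core hA hα0 hα1 hN h h1 hT hF hFR hwc hw0 hw hS'1 ?_
  intro t ht
  ext x
  rw [hS'2 t ht, hw' (t - N) ⟨by linarith [ht.1], by linarith [ht.2]⟩]
  simp only [add_sub_cancel]

lemma ext_exists {A : X →ₗ.[ℂ] X} (hA : IsClosed (A.graph : Set (X × X))) {α N T : ℝ} (hα0 : 0 < α)
    (hα1 : α < 1) (hN : 0 < N) (hT : 0 < T) {S S1 : ℝ → X →L[ℂ] X}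
    (h : IsResolventFamily A (gfun α) (gfun α) (Ioc 0 N) S)
    (h1 : IsResolventFamily A (gfun α) (gfun α) (Ioc 0 T) S1) :
    ∃ S', IsResolventFamily A (gfun α) (gfun α) (Ioc 0 (N + T)) S' := by
  obtain ⟨F, w, hF, hFR, hwc, hw0, hw, hw'⟩ := ext_w hα0 hα1 hN hT h h1
  refine ⟨fun t => if t ≤ N then S t else w (t - N), ext_core hA hα0 hα1 hN h h1 hT hF hFR hwc hw0 hw ?_ ?_⟩
  · intro t ht
    simp only [if_pos ht.2]
  · intro t ht
    simp only [if_neg (not_le.2 ht.1)]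

lemma ext_all {A : X →ₗ.[ℂ] X} (hA : IsClosed (A.graph : Set (X × X))) {α T : ℝ} (hα0 : 0 < α)
    (hα1 : α < 1) (hT : 0 < T) {S1 : ℝ → X →L[ℂ] X}
    (h1 : IsResolventFamily A (gfun α) (gfun α) (Ioc 0 T) S1) (L : ℝ) :
    ∃ S', IsResolventFamily A (gfun α) (gfun α) (Ioc 0 L) S' := by
  have key : ∀ m : ℕ, ∃ S', IsResolventFamily A (gfun α) (gfun α) (Ioc 0 (((m : ℝ) + 1) * T)) S' := by
    intro m
    induction m with
    | zero => exact ⟨S1, by simpa using h1⟩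
    | succ m ih =>
      obtain ⟨S, hS⟩ := ih
      obtain ⟨S', hS'⟩ := ext_exists hA hα0 hα1 (by positivity) hT hS h1
      refine ⟨S', ?_⟩
      push_cast
      rw [show ((m : ℝ) + 1 + 1) * T = ((m : ℝ) + 1) * T + T by ring]
      exact hS'
  obtain ⟨m, hm⟩ := exists_nat_ge (L / T)
  obtain ⟨S', hS'⟩ := key m
  refine ⟨S', res_mono hS' (Ioc_subset_Ioc_right ?_)⟩
  rw [div_le_iff₀ hT] at hm
  linarith

lemma ext_global {A : X →ₗ.[ℂ] X} (hA : IsClosed (A.graph : Set (X × X))) {α : ℝ} (hα0 : 0 < α)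
    (hall : ∀ L : ℝ, ∃ S', IsResolventFamily A (gfun α) (gfun α) (Ioc 0 L) S') :
    ∃ S', IsResolventFamily A (gfun α) (gfun α) (Ioi 0) S' := by
  choose S hS using hall
  have hu : ∀ L, ∀ t ∈ Ioc 0 L, S t t = S L t := by
    intro L t ht
    exact res_unique hA hα0 ht.1 (hS t) (res_mono (hS L) (Ioc_subset_Ioc_right ht.2)) t ⟨ht.1, le_rfl⟩
  refine ⟨fun t => S t t, res_mk ?_ ?_ ?_ ?_⟩
  · intro x t ht
    have ht' : 0 < t := ht
    have c1 : ContinuousOn (fun r => S r r x) (Ioc 0 (t + 1)) :=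
      ((hS (t + 1)).1 x).congr fun r hr => by simp only [hu (t + 1) r hr]
    exact (c1.continuousAt (Ioc_mem_nhds ht' (by linarith))).continuousWithinAt
  · intro x
    exact tendsto_congr_fam one_pos (hu 1) ((hS 1).2.1 x)
  · intro t ht x y hxy
    exact res_comm (hS t) ⟨ht, le_rfl⟩ hxy
  · intro t ht x
    have ht' : 0 < t := ht
    rw [convOp_congr ht'.le (hu t)]
    exact res_conv (hS t) ⟨ht, le_rfl⟩ x


/-- Corollary `co-local1`: a local `(g_α,g_α)`-regularized
resolvent family, `0 < α < 1`, extends without loss of regularity to a local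
`(g_α,g_α)`-family on `(0,(n+1)T]` and to a global `(g_α,g_α)`-family. -/
theorem galpha_extension_without_jumps
    (α : ℝ) (hα0 : 0 < α) (hα1 : α < 1)
    (n : ℕ) (τ : ℝ≥0∞) (hτ : 0 < τ)
    (A : X →ₗ.[ℂ] X) (hA : IsClosed (A.graph : Set (X × X)))
    (Sfam : ℕ → ℝ → X →L[ℂ] X)
    (hS1 : IsResolventFamily A (gfun α) (gfun α)
      {t : ℝ | 0 < t ∧ ENNReal.ofReal t < τ} (Sfam 1))
    (T : ℝ) (hT : 0 < T) (hTτ : ENNReal.ofReal T < τ)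
    -- the recursive definition of the extended families:
    (hrec1 : ∀ m : ℕ, 1 ≤ m → m ≤ n → ∀ t ∈ Set.Ioc (0:ℝ) ((m : ℝ) * T),
      Sfam (m+1) t = Sfam m t)
    (hrec2 : ∀ m : ℕ, 1 ≤ m → m ≤ n → ∀ t ∈ Set.Ioc ((m : ℝ) * T) (((m : ℝ) + 1) * T), ∀ x : X,
      Sfam (m+1) t x =
        (α / Real.Gamma (1 - α)) •
          ∫ r₂ in (0:ℝ)..(t - (m : ℝ) * T), ∫ r₁ in (0:ℝ)..((m : ℝ) * T),
            ((t - r₁ - r₂) ^ (-1 - α)) • Sfam m r₁ (Sfam 1 r₂ x)) :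
    IsResolventFamily A (gfun α) (gfun α)
      (Set.Ioc (0:ℝ) (((n : ℝ) + 1) * T)) (Sfam (n+1))
    ∧ ∃ S : ℝ → X →L[ℂ] X,
        IsResolventFamily A (gfun α) (gfun α) (Set.Ioi (0:ℝ)) S
        ∧ ∀ t : ℝ, 0 < t → ENNReal.ofReal t < τ → S t = Sfam 1 t := by
  have h1 : IsResolventFamily A (gfun α) (gfun α) (Ioc 0 T) (Sfam 1) :=
    res_mono hS1 fun t ht => ⟨ht.1, (ENNReal.ofReal_le_ofReal ht.2).trans_lt hTτ⟩
  constructor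
  · have key : ∀ m : ℕ, m ≤ n → IsResolventFamily A (gfun α) (gfun α)
        (Set.Ioc (0:ℝ) (((m : ℝ) + 1) * T)) (Sfam (m+1)) := by
      intro m
      induction m with
      | zero => intro _; simpa using h1
      | succ m ih =>
        intro hm
        have hS := ih (by omega)
        have r1 := hrec1 (m + 1) (by omega) hm
        have r2 := hrec2 (m + 1) (by omega) hm
        push_cast at r1 r2 ⊢
        rw [show ((m : ℝ) + 1 + 1) * T = ((m : ℝ) + 1) * T + T by ring] at r2 ⊢
        exact ext_main hA hα0 hα1 (by positivity) hT hS h1 r1 r2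
    exact key n le_rfl
  · obtain ⟨S, hS⟩ := ext_global hA hα0 (ext_all hA hα0 hα1 hT h1)
    refine ⟨S, hS, fun t ht htτ => ?_⟩
    refine res_unique hA hα0 ht (res_mono hS fun r hr => hr.1) (res_mono hS1 fun r hr => ?_) t ⟨ht, le_rfl⟩
    exact ⟨hr.1, (ENNReal.ofReal_le_ofReal hr.2).trans_lt htτ⟩
end
end

section
/- Let a ∈ L¹_loc(ℝ₊) be Laplace transformable, continuous on (0,∞) and nonvanishing near 0, and let {S(t)}_{t>0} be an admissible family of bounded linear operators on a complex Banach space X satisfying lim_{t→0⁺} S(t)x/a(t) = x for all x ∈ X. Then S is an (a,a)-regularized resolvent family (i.e. S(s)(a*S)(t)x − S(t)(a*S)(s)x = a(s)(a*S)(t)x − a(t)(a*S)(s)x for all t,s>0, x∈X) if and only if for all t, s > 0 and x ∈ X: ∫₀^t ∫₀^s a(t+s−r₁−r₂) S(r₁) S(r₂)x dr₂ dr₁ = ∫₀^t ∫₀^s a(r₁) a(r₂) S(t+s−r₁−r₂)x dr₂ dr₁. -/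
open MeasureTheory Filter Set Topology

noncomputable section

variable {X : Type*} [NormedAddCommGroup X] [NormedSpace ℂ X] [CompleteSpace X]

/-- Laplace transformability of a scalar function on `ℝ₊`. -/
def LaplaceTransformable (f : ℝ → ℝ) : Prop :=
  ∃ ω : ℝ, ∀ lam : ℂ, ω < lam.re → ∃ L : ℂ,
    Tendsto (fun T : ℝ => ∫ t in (0:ℝ)..T, Complex.exp (-(lam * t)) * (f t : ℂ))
      atTop (nhds L)

/-- An admissible operator family: strongly continuous on `(0,∞)`, commuting,
and Laplace transformable. -/
def Admissible (S : ℝ → X →L[ℂ] X) : Prop :=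
  (∀ x : X, ContinuousOn (fun t => S t x) (Set.Ioi (0:ℝ))) ∧
  (∀ t s : ℝ, 0 < t → 0 < s → ∀ x : X, S t (S s x) = S s (S t x)) ∧
  (∃ ω : ℝ, ∀ lam : ℂ, ω < lam.re → ∀ x : X, ∃ L : X,
    Tendsto (fun T : ℝ => ∫ t in (0:ℝ)..T, Complex.exp (-(lam * t)) • S t x)
      atTop (nhds L))

/-- The open triangle `0 < p₁, 0 < p₂, p₁ + p₂ < u`. -/
def triSet (u : ℝ) : Set (ℝ × ℝ) := {p | 0 < p.1 ∧ 0 < p.2 ∧ p.1 + p.2 < u}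

theorem isOpen_triSet (u : ℝ) : IsOpen (triSet u) :=
  (isOpen_lt continuous_const continuous_fst).inter
    ((isOpen_lt continuous_const continuous_snd).inter
      (isOpen_lt (continuous_fst.add continuous_snd) continuous_const))

theorem tri_swap {u : ℝ} {f : ℝ × ℝ → X} (hf : IntegrableOn f (triSet u)) :
    IntegrableOn (fun p : ℝ × ℝ => f (p.2, p.1)) (triSet u) := by
  rw [← integrable_indicator_iff (isOpen_triSet u).measurableSet] at hf ⊢
  have := hf.swap
  refine this.congr (ae_of_all _ fun p => ?_)
  by_cases h : p ∈ triSet u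
  · have h' : p.swap ∈ triSet u := ⟨h.2.1, h.1, by have := h.2.2; simp; linarith⟩
    simp only [Function.comp, indicator_of_mem h, indicator_of_mem h']; rfl
  · have h' : p.swap ∉ triSet u := fun h' =>
      h ⟨h'.2.1, h'.1, by have := h'.2.2; simp at this; linarith⟩
    simp only [Function.comp, indicator_of_notMem h, indicator_of_notMem h']

theorem tri_section {u τ : ℝ} (f : ℝ × ℝ → X) (h0 : 0 < τ) (h1 : τ < u) :
    ∫ r, (triSet u).indicator f (τ, r) = ∫ r in (0:ℝ)..(u - τ), f (τ, r) := by
  rw [intervalIntegral.integral_of_le (by linarith), integral_Ioc_eq_integral_Ioo,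
    ← integral_indicator measurableSet_Ioo]
  congr 1
  ext r
  by_cases h : r ∈ Ioo 0 (u - τ)
  · have h' : (τ, r) ∈ triSet u := ⟨h0, h.1, by have := h.2; simp; linarith⟩
    rw [indicator_of_mem h, indicator_of_mem h']
  · have h' : (τ, r) ∉ triSet u := fun h' =>
      h ⟨h'.2.1, by have := h'.2.2; simp at this; linarith⟩
    rw [indicator_of_notMem h, indicator_of_notMem h']

theorem tri_int_left {u t : ℝ} (f : ℝ × ℝ → X) (hf : IntegrableOn f (triSet u))
    (h0 : 0 ≤ t) (h1 : t < u) :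
    IntervalIntegrable (fun τ => ∫ r in (0:ℝ)..(u - τ), f (τ, r)) volume 0 t := by
  rw [← integrable_indicator_iff (isOpen_triSet u).measurableSet] at hf
  have h := (hf.integral_prod_left).intervalIntegrable (a := 0) (b := t)
  refine h.congr fun τ hτ => ?_
  rw [uIoc_of_le h0] at hτ
  exact tri_section f hτ.1 (hτ.2.trans_lt h1)

theorem tri_int_right {u t : ℝ} (f : ℝ × ℝ → X) (hf : IntegrableOn f (triSet u))
    (h0 : 0 ≤ t) (h1 : t < u) :
    IntervalIntegrable (fun τ => ∫ r in (0:ℝ)..τ, f (r, u - τ)) volume 0 t := by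
  have hf' := tri_swap hf
  rw [← integrable_indicator_iff (isOpen_triSet u).measurableSet] at hf'
  have h := ((hf'.integral_prod_left).comp_sub_left u).intervalIntegrable (a := 0) (b := t)
  refine h.congr fun τ hτ => ?_
  rw [uIoc_of_le h0] at hτ
  have := tri_section (u := u) (τ := u - τ) (fun p : ℝ × ℝ => f (p.2, p.1))
    (by linarith [hτ.2]) (by linarith [hτ.1])
  simp only [sub_sub_cancel] at this
  exact this

theorem tri_identity {t s : ℝ} (ht : 0 < t) (hs : 0 < s) (f : ℝ × ℝ → X)
    (hf : IntegrableOn f (triSet (t + s))) :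
    (∫ τ in (0:ℝ)..t, ∫ r in (0:ℝ)..(t + s - τ), f (τ, r)) =
      (∫ r₁ in (0:ℝ)..t, ∫ r₂ in (0:ℝ)..s, f (r₁, r₂)) +
        ∫ τ in (0:ℝ)..t, ∫ r in (0:ℝ)..τ, f (r, t + s - τ) := by
  set u := t + s with hu
  have hT := (isOpen_triSet u).measurableSet
  have hA : MeasurableSet (triSet u ∩ {p | p.1 < t}) :=
    hT.inter (measurableSet_lt measurable_fst measurable_const)
  have hC : MeasurableSet (triSet u ∩ {p | s ≤ p.2}) :=
    hT.inter (measurableSet_le measurable_const measurable_snd)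
  have hB : MeasurableSet (Ioo 0 t ×ˢ Ioo 0 s : Set (ℝ × ℝ)) :=
    measurableSet_Ioo.prod measurableSet_Ioo
  have hBT : (Ioo 0 t ×ˢ Ioo 0 s : Set (ℝ × ℝ)) ⊆ triSet u := by
    rintro ⟨p, q⟩ ⟨h1, h2⟩
    exact ⟨h1.1, h2.1, by simpa [hu] using add_lt_add h1.2 h2.2⟩
  have hU : triSet u ∩ {p | p.1 < t} =
      (Ioo 0 t ×ˢ Ioo 0 s) ∪ (triSet u ∩ {p | s ≤ p.2}) := by
    ext ⟨p, q⟩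
    simp only [triSet, mem_inter_iff, mem_ofPred_eq, mem_union, mem_prod, mem_Ioo]
    constructor
    · rintro ⟨⟨h1, h2, h3⟩, h4⟩
      rcases lt_or_ge q s with h | h
      · exact Or.inl ⟨⟨h1, h4⟩, h2, h⟩
      · exact Or.inr ⟨⟨h1, h2, h3⟩, h⟩
    · rintro (⟨⟨h1, h4⟩, h2, h⟩ | ⟨⟨h1, h2, h3⟩, h⟩)
      · exact ⟨⟨h1, h2, by linarith⟩, h4⟩
      · exact ⟨⟨h1, h2, h3⟩, by linarith⟩
  have hD : Disjoint (Ioo 0 t ×ˢ Ioo 0 s : Set (ℝ × ℝ)) (triSet u ∩ {p | s ≤ p.2}) := by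
    rw [Set.disjoint_left]
    rintro ⟨p, q⟩ ⟨_, h2⟩ ⟨_, h3⟩
    exact absurd h2.2 (not_lt.2 h3)
  have key : (∫ p in triSet u ∩ {p | p.1 < t}, f p) =
      (∫ p in (Ioo 0 t ×ˢ Ioo 0 s : Set (ℝ × ℝ)), f p) +
        ∫ p in triSet u ∩ {p | s ≤ p.2}, f p := by
    rw [hU]
    exact setIntegral_union hD hC (hf.mono_set hBT) (hf.mono_set inter_subset_left)
  have e1 : (∫ p in triSet u ∩ {p | p.1 < t}, f p) =
      ∫ τ in (0:ℝ)..t, ∫ r in (0:ℝ)..(u - τ), f (τ, r) := by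
    rw [← integral_indicator hA, Measure.volume_eq_prod, integral_prod,
      intervalIntegral.integral_of_le ht.le, integral_Ioc_eq_integral_Ioo,
      ← integral_indicator measurableSet_Ioo]
    · congr 1
      ext τ
      by_cases h : τ ∈ Ioo 0 t
      · rw [indicator_of_mem h, ← tri_section f h.1 (by linarith [h.2])]
        congr 1
        ext r
        by_cases h' : (τ, r) ∈ triSet u
        · rw [indicator_of_mem h', indicator_of_mem (show (τ, r) ∈ triSet u ∩ _ from ⟨h', h.2⟩)]
        · rw [indicator_of_notMem h', indicator_of_notMem (fun h'' => h' h''.1)]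
      · rw [indicator_of_notMem h]
        refine integral_eq_zero_of_ae (ae_of_all _ fun r => ?_)
        exact indicator_of_notMem (fun h'' => h ⟨h''.1.1, h''.2⟩) _
    · exact (integrable_indicator_iff hA).2 (hf.mono_set inter_subset_left)
  have e2 : (∫ p in (Ioo 0 t ×ˢ Ioo 0 s : Set (ℝ × ℝ)), f p) =
      ∫ r₁ in (0:ℝ)..t, ∫ r₂ in (0:ℝ)..s, f (r₁, r₂) := by
    rw [Measure.volume_eq_prod, setIntegral_prod _ (hf.mono_set hBT),
      intervalIntegral.integral_of_le ht.le, integral_Ioc_eq_integral_Ioo]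
    simp only [intervalIntegral.integral_of_le hs.le, integral_Ioc_eq_integral_Ioo]
  have e3 : (∫ p in triSet u ∩ {p | s ≤ p.2}, f p) =
      ∫ τ in (0:ℝ)..t, ∫ r in (0:ℝ)..τ, f (r, u - τ) := by
    have e4 := intervalIntegral.integral_comp_sub_left (a := 0) (b := t)
      (fun y => ∫ r in (0:ℝ)..(u - y), f (r, y)) u
    simp only [sub_sub_cancel, sub_zero] at e4
    rw [e4, show u - t = s by simp [hu]]
    rw [← integral_indicator hC, Measure.volume_eq_prod, integral_prod_symm,
      intervalIntegral.integral_of_le (by linarith), integral_Ioc_eq_integral_Ioo,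
      ← integral_Ico_eq_integral_Ioo, ← integral_indicator measurableSet_Ico]
    · congr 1
      ext τ
      by_cases h : τ ∈ Ico s u
      · rw [indicator_of_mem h]
        have e5 := tri_section (u := u) (τ := τ) (fun p : ℝ × ℝ => f (p.2, p.1))
          (by linarith [h.1]) h.2
        simp only at e5
        rw [← e5]
        congr 1
        ext r
        by_cases h' : (τ, r) ∈ triSet u
        · rw [indicator_of_mem h', indicator_of_mem (show (r, τ) ∈ triSet u ∩ _ from
            ⟨⟨h'.2.1, h'.1, by have := h'.2.2; simp at this ⊢; linarith⟩, h.1⟩)]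
        · rw [indicator_of_notMem h', indicator_of_notMem (fun h'' => h'
            ⟨h''.1.2.1, h''.1.1, by have := h''.1.2.2; simp at this ⊢; linarith⟩)]
      · rw [indicator_of_notMem h]
        refine integral_eq_zero_of_ae (ae_of_all _ fun r => ?_)
        exact indicator_of_notMem (fun h'' => h ⟨h''.2, by
          have h1 := h''.1.2.2
          have h2 := h''.1.1
          simp at h1 h2
          linarith⟩) _
    · exact (integrable_indicator_iff hC).2 (hf.mono_set inter_subset_left)
  rw [← e1, ← e2, ← e3, key]

theorem S_bound (a : ℝ → ℝ) (hacont : ContinuousOn a (Set.Ioi (0:ℝ)))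
    (ha0 : ∃ σ > (0:ℝ), ∀ t ∈ Set.Ioo (0:ℝ) σ, a t ≠ 0)
    (S : ℝ → X →L[ℂ] X)
    (hSc : ∀ x : X, ContinuousOn (fun t => S t x) (Set.Ioi (0:ℝ)))
    (hlim : ∀ x : X,
      Tendsto (fun t => (a t)⁻¹ • S t x) (nhdsWithin 0 (Set.Ioi 0)) (nhds x)) (u : ℝ) :
    ∃ M : ℝ, 0 ≤ M ∧ ∀ t ∈ Ioc 0 u, ‖S t‖ ≤ M * (|a t| + 1) := by
  obtain ⟨σ, hσ, ha0⟩ := ha0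
  have hb : ∀ t, 0 < |a t| + 1 := fun t => by positivity
  obtain ⟨M, hM⟩ := banach_steinhaus (ι := Ioc (0:ℝ) u)
    (g := fun t => ((|a t| + 1 : ℝ) : ℂ)⁻¹ • S t) (by
      intro x
      have h1 : ∀ᶠ t in nhdsWithin (0:ℝ) (Ioi 0), ‖(a t)⁻¹ • S t x‖ < ‖x‖ + 1 :=
        (hlim x).norm.eventually (gt_mem_nhds (by linarith))
      have h2 : ∀ᶠ t in nhdsWithin (0:ℝ) (Ioi 0), t ∈ Ioo 0 σ := Ioo_mem_nhdsGT hσ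
      obtain ⟨δ, hδ, hδ'⟩ := mem_nhdsGT_iff_exists_Ioo_subset.1 (h1.and h2)
      have hδ0 : (0:ℝ) < δ := hδ
      obtain ⟨C, hC⟩ := (isCompact_Icc (a := δ) (b := u)).exists_bound_of_continuousOn
        ((hSc x).mono fun t ht => hδ0.trans_le ht.1)
      refine ⟨max (‖x‖ + 1) C, fun ⟨t, ht⟩ => ?_⟩
      have e : ‖(((|a t| + 1 : ℝ) : ℂ)⁻¹ • S t) x‖ = ‖S t x‖ / (|a t| + 1) := by
        rw [ContinuousLinearMap.smul_apply, norm_smul, norm_inv, Complex.norm_real,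
          Real.norm_of_nonneg (hb t).le, div_eq_inv_mul]
      simp only [] at e ⊢
      rw [e, div_le_iff₀ (hb t)]
      have hx : 0 ≤ ‖x‖ := norm_nonneg x
      have ha : 0 ≤ |a t| := abs_nonneg _
      have hm : 0 ≤ max (‖x‖ + 1) C := le_max_of_le_left (by positivity)
      rcases lt_or_ge t δ with h | h
      · obtain ⟨h3, h4⟩ := hδ' ⟨ht.1, h⟩
        have h5 : 0 < |a t| := abs_pos.2 (ha0 t h4)
        rw [norm_smul, norm_inv, Real.norm_eq_abs, ← div_eq_inv_mul, div_lt_iff₀ h5] at h3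
        have : (‖x‖ + 1) * |a t| ≤ max (‖x‖ + 1) C * |a t| := by gcongr; exact le_max_left _ _
        nlinarith
      · have := hC t ⟨h, ht.2⟩
        have := le_max_right (‖x‖ + 1) C
        nlinarith)
  refine ⟨max M 0, le_max_right _ _, fun t ht => ?_⟩
  have := hM ⟨t, ht⟩
  simp only [] at this
  rw [norm_smul, norm_inv, Complex.norm_real, Real.norm_of_nonneg (hb t).le, ← div_eq_inv_mul,
    div_le_iff₀ (hb t)] at this
  refine this.trans ?_
  gcongr
  exact le_max_left _ _

theorem S_jcont (a : ℝ → ℝ) (hacont : ContinuousOn a (Set.Ioi (0:ℝ)))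
    (S : ℝ → X →L[ℂ] X)
    (hSc : ∀ x : X, ContinuousOn (fun t => S t x) (Set.Ioi (0:ℝ)))
    (hB : ∀ u : ℝ, ∃ M : ℝ, 0 ≤ M ∧ ∀ t ∈ Ioc 0 u, ‖S t‖ ≤ M * (|a t| + 1)) :
    ContinuousOn (fun p : ℝ × X => S p.1 p.2) (Ioi 0 ×ˢ univ) := by
  rintro ⟨t, x⟩ ⟨ht, -⟩
  have ht : 0 < t := ht
  obtain ⟨M, hM0, hM⟩ := hB (2 * t)
  obtain ⟨C, hC⟩ := (isCompact_Icc (a := t / 2) (b := 2 * t)).exists_bound_of_continuousOn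
        (hacont.mono fun r hr => show 0 < r by linarith [hr.1])
  have hl : ContinuousOn (fun p : X × ℝ => S p.2 p.1) (univ ×ˢ Icc (t/2) (2*t)) := by
    refine continuousOn_prod_of_continuousOn_lipschitzOnWith _ (Real.toNNReal (M * (C + 1))) ?_ ?_
    · intro y _
      exact (hSc y).mono fun r hr => show 0 < r by linarith [hr.1]
    · intro r hr
      refine ((S r).lipschitz.weaken ?_).lipschitzOnWith
      rw [← NNReal.coe_le_coe, coe_nnnorm]
      refine le_trans ?_ (Real.le_coe_toNNReal _)
      refine (hM r ⟨by linarith [hr.1], hr.2⟩).trans ?_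
      gcongr
      exact hC r hr
  have h2 : ContinuousAt (fun p : X × ℝ => S p.2 p.1) (x, t) :=
    hl.continuousAt (prod_mem_nhds univ_mem (Icc_mem_nhds (by linarith) (by linarith)))
  have h3 : ContinuousAt (fun p : ℝ × X => S p.1 p.2) (t, x) :=
    ContinuousAt.comp (g := fun p : X × ℝ => S p.2 p.1) (f := Prod.swap) (x := (t, x)) h2
      continuous_swap.continuousAt
  exact h3.continuousWithinAt

theorem b_tri (b : ℝ → ℝ) (hb : ContinuousOn b (Ioi 0)) (hb0 : ∀ t, 0 ≤ b t) {u : ℝ}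
    (hu : 0 < u) (hbi : IntegrableOn b (Ioo 0 u)) :
    IntegrableOn (fun p : ℝ × ℝ => b p.1 * b p.2 * b (u - p.1 - p.2)) (triSet u) := by
  have hβ : Integrable ((Ioo 0 u).indicator b) := (integrable_indicator_iff measurableSet_Ioo).2 hbi
  set β := (Ioo 0 u).indicator b with hβd
  have i1 : Integrable (fun p : ℝ × ℝ => β p.1 * β p.2) := hβ.mul_prod hβ
  have i2 : Integrable (fun p : ℝ × ℝ => β p.2 * β (u - p.1 - p.2)) := by
    have h := hβ.convolution_integrand (ContinuousLinearMap.mul ℝ ℝ) hβ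
    exact ((Measure.measurePreserving_sub_left (volume : Measure ℝ) u).prod
      (MeasurePreserving.id (volume : Measure ℝ))).integrable_comp_of_integrable h
  have i3 : Integrable (fun p : ℝ × ℝ => β p.1 * β (u - p.1 - p.2)) := by
    refine i2.swap.congr (ae_of_all _ fun p => ?_)
    simp [Function.comp, sub_right_comm]
  obtain ⟨C, hC⟩ := (isCompact_Icc (a := u / 3) (b := u)).exists_bound_of_continuousOn
        (hb.mono fun r hr => show 0 < r by linarith [hr.1])
  have hC0 : 0 ≤ C := (norm_nonneg _).trans (hC u ⟨by linarith, le_rfl⟩)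
  have hC' : ∀ r, u / 3 ≤ r → r ≤ u → b r ≤ C := fun r h1 h2 =>
    (le_abs_self _).trans (hC r ⟨h1, h2⟩)
  refine Integrable.mono' (g := fun p => C * (β p.1 * β p.2 + β p.2 * β (u - p.1 - p.2)
    + β p.1 * β (u - p.1 - p.2))) (((i1.add i2).add i3).const_mul C).integrableOn ?_ ?_
  · refine ContinuousOn.aestronglyMeasurable ?_ (isOpen_triSet u).measurableSet
    refine ContinuousOn.mul (ContinuousOn.mul ?_ ?_) ?_
    · exact hb.comp continuousOn_fst fun p hp => hp.1
    · exact hb.comp continuousOn_snd fun p hp => hp.2.1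
    · exact hb.comp (by fun_prop) fun p hp => by
        have := hp.2.2
        simp only [mem_Ioi]; linarith
  · refine (ae_restrict_iff' (isOpen_triSet u).measurableSet).2 (ae_of_all _ ?_)
    rintro ⟨p, q⟩ ⟨h1, h2, h3⟩
    simp only at h1 h2 h3 ⊢
    have hw : u - p - q ∈ Ioo 0 u := ⟨by linarith, by linarith⟩
    rw [hβd, indicator_of_mem (show p ∈ Ioo 0 u from ⟨h1, by linarith⟩),
      indicator_of_mem (show q ∈ Ioo 0 u from ⟨h2, by linarith⟩), indicator_of_mem hw]
    have p1 := hb0 p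
    have p2 := hb0 q
    have p3 := hb0 (u - p - q)
    rw [Real.norm_of_nonneg (by positivity)]
    have q1 := mul_nonneg p1 p2
    have q2 := mul_nonneg p2 p3
    have q3 := mul_nonneg p1 p3
    rcases le_or_gt (u/3) p with h | h
    · have := mul_le_mul_of_nonneg_left (hC' p h (by linarith)) q2
      nlinarith [mul_nonneg hC0 q1, mul_nonneg hC0 q3]
    rcases le_or_gt (u/3) q with h' | h'
    · have := mul_le_mul_of_nonneg_left (hC' q h' (by linarith)) q3
      nlinarith [mul_nonneg hC0 q1, mul_nonneg hC0 q2]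
    · have := mul_le_mul_of_nonneg_left (hC' (u - p - q) (by linarith) (by linarith)) q1
      nlinarith [mul_nonneg hC0 q3, mul_nonneg hC0 q2]

theorem half_cont (φ : ℝ → ℝ → X) (b c : ℝ → ℝ) {τ₀ : ℝ} (h0 : 0 < τ₀)
    (hφ : ContinuousOn (fun p : ℝ × ℝ => φ p.1 p.2) (Ioi 0 ×ˢ Ioi 0))
    (hc : ContinuousOn c (Ioi 0)) (hbi : IntegrableOn b (Ioo 0 τ₀))
    (hb0 : ∀ r, 0 ≤ b r)
    (hle : ∀ r ∈ Ioc 0 (2 * τ₀), ∀ w ∈ Ioc 0 (2 * τ₀), ‖φ r w‖ ≤ b r * c w) :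
    ContinuousAt (fun τ => ∫ r in (0:ℝ)..(τ / 2), φ r (τ - r)) τ₀ := by
  have hpos : ∀ᶠ τ in nhds τ₀, τ ∈ Ioo (τ₀ / 2) (3 * τ₀ / 2) :=
    Ioo_mem_nhds (by linarith) (by linarith)
  have heq : (fun τ => ∫ r in (0:ℝ)..(τ / 2), φ r (τ - r)) =ᶠ[nhds τ₀]
      fun τ => ∫ r, (Ioo 0 (τ / 2)).indicator (fun r => φ r (τ - r)) r := by
    filter_upwards [hpos] with τ hτ
    rw [intervalIntegral.integral_of_le (by linarith [hτ.1]), integral_Ioc_eq_integral_Ioo,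
      integral_indicator measurableSet_Ioo]
  refine ContinuousAt.congr ?_ heq.symm
  obtain ⟨C, hC⟩ := (isCompact_Icc (a := τ₀ / 4) (b := 2 * τ₀)).exists_bound_of_continuousOn
        (hc.mono fun r hr => show 0 < r by linarith [hr.1])
  have hC0 : 0 ≤ C := (norm_nonneg _).trans (hC τ₀ ⟨by linarith, by linarith⟩)
  refine continuousAt_of_dominated (bound := (Ioo 0 τ₀).indicator fun r => b r * C) ?_ ?_ ?_ ?_
  · filter_upwards [hpos] with τ hτ
    rw [aestronglyMeasurable_indicator_iff measurableSet_Ioo]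
    refine ContinuousOn.aestronglyMeasurable ?_ measurableSet_Ioo
    refine hφ.comp (f := fun r => (r, τ - r)) (by fun_prop) fun r hr => ⟨hr.1, ?_⟩
    have := hr.2
    have := hr.1
    simp only [mem_Ioi]; linarith
  · filter_upwards [hpos] with τ hτ
    refine ae_of_all _ fun r => ?_
    by_cases hr : r ∈ Ioo 0 (τ / 2)
    · obtain ⟨t1, t2⟩ := hτ
      obtain ⟨r1, r2⟩ := hr
      rw [indicator_of_mem (show r ∈ Ioo 0 (τ / 2) from ⟨r1, r2⟩),
        indicator_of_mem (show r ∈ Ioo 0 τ₀ from ⟨r1, by linarith⟩)]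
      refine (hle r ⟨r1, by linarith⟩ (τ - r) ⟨by linarith, by linarith⟩).trans ?_
      refine mul_le_mul_of_nonneg_left ?_ (hb0 r)
      exact (le_abs_self _).trans (hC _ ⟨by linarith, by linarith⟩)
    · rw [indicator_of_notMem hr, norm_zero]
      exact indicator_nonneg (fun r _ => mul_nonneg (hb0 r) hC0) _
  · rw [integrable_indicator_iff measurableSet_Ioo]
    exact hbi.mul_const C
  · have : ∀ᵐ r : ℝ, r ≠ τ₀ / 2 := by simp [ae_iff]
    filter_upwards [this] with r hr
    rcases le_or_gt r 0 with h | h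
    · refine (continuousAt_const (y := (0 : X))).congr (Eventually.of_forall fun τ => ?_)
      exact (indicator_of_notMem (fun h' => absurd h'.1 (not_lt.2 h)) _).symm
    rcases lt_or_gt_of_ne hr with h' | h'
    · have : ContinuousAt (fun τ => φ r (τ - r)) τ₀ := by
        refine ContinuousAt.comp (g := fun p : ℝ × ℝ => φ p.1 p.2) (f := fun τ => (r, τ - r))
          (hφ.continuousAt (prod_mem_nhds (Ioi_mem_nhds h) (Ioi_mem_nhds ?_))) (by fun_prop)
        linarith
      refine this.congr ?_
      filter_upwards [Ioi_mem_nhds (show 2 * r < τ₀ by linarith)] with τ hτ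
      have hτ : 2 * r < τ := hτ
      rw [indicator_of_mem (show r ∈ Ioo 0 (τ / 2) from ⟨h, by linarith⟩)]
    · refine (continuousAt_const (y := (0 : X))).congr ?_
      filter_upwards [Iio_mem_nhds (show τ₀ < 2 * r by linarith)] with τ hτ
      have hτ : τ < 2 * r := hτ
      exact (indicator_of_notMem (fun h' => absurd h'.2 (not_lt.2 (by linarith))) _).symm

theorem b_int (a : ℝ → ℝ) (hai : ∀ u, IntegrableOn a (Ioo 0 u)) (u : ℝ) :
    IntegrableOn (fun t => |a t| + 1) (Ioo 0 u) :=
  (hai u).abs.add (integrableOn_const (by simp))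

theorem Sx_int (a : ℝ → ℝ) (hai : ∀ u, IntegrableOn a (Ioo 0 u))
    (S : ℝ → X →L[ℂ] X)
    (hSc : ∀ x : X, ContinuousOn (fun t => S t x) (Set.Ioi (0:ℝ)))
    (hB : ∀ u : ℝ, ∃ M : ℝ, 0 ≤ M ∧ ∀ t ∈ Ioc 0 u, ‖S t‖ ≤ M * (|a t| + 1)) (u : ℝ) (x : X) :
    IntegrableOn (fun t => S t x) (Ioo 0 u) := by
  obtain ⟨M, hM0, hM⟩ := hB u
  refine Integrable.mono' (((b_int a hai u).const_mul M).mul_const ‖x‖) ?_ ?_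
  · exact ContinuousOn.aestronglyMeasurable ((hSc x).mono fun r hr => hr.1) measurableSet_Ioo
  · refine (ae_restrict_iff' measurableSet_Ioo).2 (ae_of_all _ fun t ht => ?_)
    exact (S t).le_of_opNorm_le (hM t ⟨ht.1, ht.2.le⟩) x

theorem conv_int (a : ℝ → ℝ) (hacont : ContinuousOn a (Set.Ioi (0:ℝ)))
    (hai : ∀ u, IntegrableOn a (Ioo 0 u)) (S : ℝ → X →L[ℂ] X)
    (hSc : ∀ x : X, ContinuousOn (fun t => S t x) (Set.Ioi (0:ℝ)))
    (hB : ∀ u : ℝ, ∃ M : ℝ, 0 ≤ M ∧ ∀ t ∈ Ioc 0 u, ‖S t‖ ≤ M * (|a t| + 1))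
    {τ : ℝ} (hτ : 0 < τ) (x : X) :
    IntervalIntegrable (fun r => a (τ - r) • S r x) volume 0 (τ / 2) ∧
    IntervalIntegrable (fun r => a (τ - r) • S r x) volume (τ / 2) τ := by
  constructor
  · refine IntervalIntegrable.continuousOn_smul ?_ ?_
    · rw [intervalIntegrable_iff_integrableOn_Ioo_of_le (by linarith)]
      exact Sx_int a hai S hSc hB _ x
    · rw [uIcc_of_le (by linarith)]
      exact hacont.comp (by fun_prop) fun r hr => show 0 < τ - r by linarith [hr.2]
  · refine IntervalIntegrable.smul_continuousOn ?_ ?_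
    · have h : IntervalIntegrable a volume 0 (τ / 2) := by
        rw [intervalIntegrable_iff_integrableOn_Ioo_of_le (by linarith)]
        exact hai _
      have h' := (h.comp_sub_left τ).symm
      rw [sub_zero, show τ - τ / 2 = τ / 2 by ring] at h'
      exact h'
    · rw [uIcc_of_le (by linarith)]
      exact (hSc x).mono fun r hr => show 0 < r by linarith [hr.1]

theorem conv_cont (a : ℝ → ℝ) (hacont : ContinuousOn a (Set.Ioi (0:ℝ)))
    (hai : ∀ u, IntegrableOn a (Ioo 0 u)) (S : ℝ → X →L[ℂ] X)
    (hSc : ∀ x : X, ContinuousOn (fun t => S t x) (Set.Ioi (0:ℝ)))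
    (hB : ∀ u : ℝ, ∃ M : ℝ, 0 ≤ M ∧ ∀ t ∈ Ioc 0 u, ‖S t‖ ≤ M * (|a t| + 1))
    {τ₀ : ℝ} (h0 : 0 < τ₀) (x : X) :
    ContinuousAt (fun τ => convOp a S τ x) τ₀ := by
  have heq : (fun τ => (∫ r in (0:ℝ)..(τ / 2), a (τ - r) • S r x)
      + ∫ r in (0:ℝ)..(τ / 2), a r • S (τ - r) x) =ᶠ[nhds τ₀] fun τ => convOp a S τ x := by
    filter_upwards [Ioi_mem_nhds h0] with τ hτ
    obtain ⟨i1, i2⟩ := conv_int a hacont hai S hSc hB (τ := τ) hτ x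
    rw [convOp, ← intervalIntegral.integral_add_adjacent_intervals i1 i2]
    congr 1
    have := intervalIntegral.integral_comp_sub_left (a := 0) (b := τ / 2)
      (fun r => a (τ - r) • S r x) τ
    simp only [sub_sub_cancel, sub_zero] at this
    rw [this]
    congr 1
    ring
  refine ContinuousAt.congr ?_ heq
  obtain ⟨M, hM0, hM⟩ := hB (2 * τ₀)
  have hb : ContinuousOn (fun t => |a t| + 1) (Ioi 0) := hacont.abs.add continuousOn_const
  refine ContinuousAt.add ?_ ?_
  · refine half_cont (fun r w => a w • S r x) (fun r => M * (|a r| + 1) * ‖x‖) (fun w => |a w|)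
      h0 ?_ hacont.abs (((b_int a hai _).const_mul M).mul_const ‖x‖) (fun r => by positivity) ?_
    · exact (hacont.comp continuousOn_snd fun p hp => hp.2).smul
        ((hSc x).comp continuousOn_fst fun p hp => hp.1)
    · intro r hr w hw
      rw [norm_smul, Real.norm_eq_abs, mul_comm]
      gcongr
      exact (S r).le_of_opNorm_le (hM r hr) x
  · refine half_cont (fun r w => a r • S w x) (fun r => |a r|) (fun w => M * (|a w| + 1) * ‖x‖)
      h0 ?_ ((continuousOn_const.mul hb).mul continuousOn_const) (hai _).abs
      (fun r => by positivity) ?_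
    · exact (hacont.comp continuousOn_fst fun p hp => hp.1).smul
        ((hSc x).comp continuousOn_snd fun p hp => hp.2)
    · intro r hr w hw
      rw [norm_smul, Real.norm_eq_abs]
      gcongr
      exact (S w).le_of_opNorm_le (hM w hw) x

theorem f_int (a : ℝ → ℝ) (hacont : ContinuousOn a (Set.Ioi (0:ℝ)))
    (hai : ∀ u, IntegrableOn a (Ioo 0 u)) (S : ℝ → X →L[ℂ] X)
    (hSc : ∀ x : X, ContinuousOn (fun t => S t x) (Set.Ioi (0:ℝ)))
    (hB : ∀ u : ℝ, ∃ M : ℝ, 0 ≤ M ∧ ∀ t ∈ Ioc 0 u, ‖S t‖ ≤ M * (|a t| + 1))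
    {u : ℝ} (hu : 0 < u) (x : X) :
    IntegrableOn (fun p : ℝ × ℝ => a (u - p.1 - p.2) • S p.1 (S p.2 x)) (triSet u) := by
  obtain ⟨M, hM0, hM⟩ := hB u
  have hb : ContinuousOn (fun t => |a t| + 1) (Ioi 0) := hacont.abs.add continuousOn_const
  have h3 := b_tri _ hb (fun t => by positivity) hu (b_int a hai u)
  refine Integrable.mono' (h3.const_mul (M * M * ‖x‖)) ?_ ?_
  · refine ContinuousOn.aestronglyMeasurable ?_ (isOpen_triSet u).measurableSet
    have c1 : ContinuousOn (fun p : ℝ × ℝ => a (u - p.1 - p.2)) (triSet u) :=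
      hacont.comp (by fun_prop) fun p hp => by
        have := hp.2.2
        simp only [mem_Ioi]; linarith
    refine c1.smul ?_
    · refine (S_jcont a hacont S hSc hB).comp (f := fun p : ℝ × ℝ => (p.1, S p.2 x)) ?_ ?_
      · exact continuousOn_fst.prodMk ((hSc x).comp continuousOn_snd fun p hp => hp.2.1)
      · exact fun p hp => ⟨hp.1, mem_univ _⟩
  · refine (ae_restrict_iff' (isOpen_triSet u).measurableSet).2 (ae_of_all _ ?_)
    rintro ⟨p, q⟩ ⟨h1, h2, h3⟩
    simp only at h1 h2 h3 ⊢
    rw [norm_smul, Real.norm_eq_abs]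
    have e1 := (S q).le_of_opNorm_le (hM q ⟨h2, by linarith⟩) x
    have e2 := (S p).le_of_opNorm_le (hM p ⟨h1, by linarith⟩) (S q x)
    calc |a (u - p - q)| * ‖S p (S q x)‖
        ≤ (|a (u - p - q)| + 1) * ((M * (|a p| + 1)) * (M * (|a q| + 1) * ‖x‖)) := by
          refine mul_le_mul (by linarith) (e2.trans ?_) (norm_nonneg _) (by positivity)
          exact mul_le_mul_of_nonneg_left e1 (by positivity)
      _ = _ := by ring

theorem g_int (a : ℝ → ℝ) (hacont : ContinuousOn a (Set.Ioi (0:ℝ)))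
    (hai : ∀ u, IntegrableOn a (Ioo 0 u)) (S : ℝ → X →L[ℂ] X)
    (hSc : ∀ x : X, ContinuousOn (fun t => S t x) (Set.Ioi (0:ℝ)))
    (hB : ∀ u : ℝ, ∃ M : ℝ, 0 ≤ M ∧ ∀ t ∈ Ioc 0 u, ‖S t‖ ≤ M * (|a t| + 1))
    {u : ℝ} (hu : 0 < u) (x : X) :
    IntegrableOn (fun p : ℝ × ℝ => (a p.1 * a p.2) • S (u - p.1 - p.2) x) (triSet u) := by
  obtain ⟨M, hM0, hM⟩ := hB u
  have hb : ContinuousOn (fun t => |a t| + 1) (Ioi 0) := hacont.abs.add continuousOn_const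
  have h3 := b_tri _ hb (fun t => by positivity) hu (b_int a hai u)
  refine Integrable.mono' (h3.const_mul (M * ‖x‖)) ?_ ?_
  · refine ContinuousOn.aestronglyMeasurable ?_ (isOpen_triSet u).measurableSet
    have c1 : ContinuousOn (fun p : ℝ × ℝ => a p.1) (triSet u) :=
      hacont.comp continuousOn_fst fun p hp => hp.1
    have c2 : ContinuousOn (fun p : ℝ × ℝ => a p.2) (triSet u) :=
      hacont.comp continuousOn_snd fun p hp => hp.2.1
    refine (c1.mul c2).smul ?_
    · exact (hSc x).comp (by fun_prop) fun p hp => by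
        have := hp.2.2
        simp only [mem_Ioi]; linarith
  · refine (ae_restrict_iff' (isOpen_triSet u).measurableSet).2 (ae_of_all _ ?_)
    rintro ⟨p, q⟩ ⟨h1, h2, h3⟩
    simp only at h1 h2 h3 ⊢
    rw [norm_smul, Real.norm_eq_abs, abs_mul]
    have e1 := (S (u - p - q)).le_of_opNorm_le (hM (u - p - q) ⟨by linarith, by linarith⟩) x
    calc |a p| * |a q| * ‖S (u - p - q) x‖
        ≤ ((|a p| + 1) * (|a q| + 1)) * (M * (|a (u - p - q)| + 1) * ‖x‖) := by
          refine mul_le_mul ?_ e1 (norm_nonneg _) (by positivity)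
          exact mul_le_mul (by linarith) (by linarith) (abs_nonneg _) (by positivity)
      _ = _ := by ring

/-- The difference of the two sides of the resolvent functional equation. -/
def hDiff (a : ℝ → ℝ) (S : ℝ → X →L[ℂ] X) (u : ℝ) (x : X) (τ : ℝ) : X :=
  (S τ (convOp a S (u - τ) x) - S (u - τ) (convOp a S τ x))
    - (a τ • convOp a S (u - τ) x - a (u - τ) • convOp a S τ x)

theorem main_identity (a : ℝ → ℝ) (hacont : ContinuousOn a (Set.Ioi (0:ℝ)))
    (hai : ∀ u, IntegrableOn a (Ioo 0 u)) (S : ℝ → X →L[ℂ] X)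
    (hSc : ∀ x : X, ContinuousOn (fun t => S t x) (Set.Ioi (0:ℝ)))
    (hcomm : ∀ t s : ℝ, 0 < t → 0 < s → ∀ x : X, S t (S s x) = S s (S t x))
    (hB : ∀ u : ℝ, ∃ M : ℝ, 0 ≤ M ∧ ∀ t ∈ Ioc 0 u, ‖S t‖ ≤ M * (|a t| + 1))
    {t s : ℝ} (ht : 0 < t) (hs : 0 < s) (x : X) :
    IntervalIntegrable (hDiff a S (t + s) x) volume 0 t ∧
    (∫ τ in (0:ℝ)..t, hDiff a S (t + s) x τ) =
      (∫ r₁ in (0:ℝ)..t, ∫ r₂ in (0:ℝ)..s, a (t + s - r₁ - r₂) • S r₁ (S r₂ x))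
        - (∫ r₁ in (0:ℝ)..t, ∫ r₂ in (0:ℝ)..s, (a r₁ * a r₂) • S (t + s - r₁ - r₂) x) := by
  set u := t + s with hu
  have hu0 : 0 < u := by linarith
  have htu : t < u := by linarith
  have hf := f_int a hacont hai S hSc hB hu0 x
  have hg := g_int a hacont hai S hSc hB hu0 x
  have hR : ∀ (σ : ℝ), 0 < σ → ∀ L : X →L[ℂ] X,
      (∫ r in (0:ℝ)..σ, a (σ - r) • L (S r x)) = L (convOp a S σ x) := by
    intro σ hσ L
    obtain ⟨i1, i2⟩ := conv_int a hacont hai S hSc hB hσ x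
    rw [convOp, ← L.intervalIntegral_comp_comm (i1.trans i2)]
    simp only [ContinuousLinearMap.map_smul_of_tower]
  have hR2 : ∀ (σ : ℝ), (∫ r in (0:ℝ)..σ, a r • S (σ - r) x) = convOp a S σ x := by
    intro σ
    have := intervalIntegral.integral_comp_sub_left (a := 0) (b := σ)
      (fun r => a (σ - r) • S r x) σ
    simp only [sub_sub_cancel, sub_zero, sub_self] at this
    exact this
  have f1 : ∀ τ ∈ uIoc 0 t, (∫ r in (0:ℝ)..(u - τ), a (u - τ - r) • S τ (S r x)) =
      S τ (convOp a S (u - τ) x) := by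
    intro τ hτ
    rw [uIoc_of_le ht.le] at hτ
    exact hR _ (by linarith [hτ.2]) _
  have f2 : ∀ τ ∈ uIoc 0 t, (∫ r in (0:ℝ)..τ, a (u - r - (u - τ)) • S r (S (u - τ) x)) =
      S (u - τ) (convOp a S τ x) := by
    intro τ hτ
    rw [uIoc_of_le ht.le] at hτ
    rw [← hR _ hτ.1]
    refine intervalIntegral.integral_congr_ae (ae_of_all _ fun r hr => ?_)
    rw [uIoc_of_le hτ.1.le] at hr
    rw [hcomm r (u - τ) hr.1 (by linarith [hτ.2])]
    congr 2
    ring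
  have g1 : ∀ τ ∈ uIoc 0 t, (∫ r in (0:ℝ)..(u - τ), (a τ * a r) • S (u - τ - r) x) =
      a τ • convOp a S (u - τ) x := by
    intro τ hτ
    rw [← hR2, ← intervalIntegral.integral_smul]
    simp only [mul_smul]
  have g2 : ∀ τ ∈ uIoc 0 t, (∫ r in (0:ℝ)..τ, (a r * a (u - τ)) • S (u - r - (u - τ)) x) =
      a (u - τ) • convOp a S τ x := by
    intro τ hτ
    rw [← hR2, ← intervalIntegral.integral_smul]
    congr 1
    ext r
    rw [mul_comm, mul_smul, show u - r - (u - τ) = τ - r by ring]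
  have if1 := (tri_int_left _ hf ht.le htu).congr f1
  have if2 := (tri_int_right _ hf ht.le htu).congr f2
  have ig1 := (tri_int_left _ hg ht.le htu).congr g1
  have ig2 := (tri_int_right _ hg ht.le htu).congr g2
  have ef := tri_identity ht hs _ hf
  have eg := tri_identity ht hs _ hg
  simp only [← hu] at ef eg
  rw [intervalIntegral.integral_congr_ae (ae_of_all _ f1),
    intervalIntegral.integral_congr_ae (ae_of_all _ f2)] at ef
  rw [intervalIntegral.integral_congr_ae (ae_of_all _ g1),
    intervalIntegral.integral_congr_ae (ae_of_all _ g2)] at eg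
  refine ⟨(if1.sub if2).sub (ig1.sub ig2), ?_⟩
  simp only [hDiff]
  rw [intervalIntegral.integral_sub (if1.sub if2) (ig1.sub ig2),
    intervalIntegral.integral_sub if1 if2, intervalIntegral.integral_sub ig1 ig2, ef, eg]
  abel

theorem hDiff_cont (a : ℝ → ℝ) (hacont : ContinuousOn a (Set.Ioi (0:ℝ)))
    (hai : ∀ u, IntegrableOn a (Ioo 0 u)) (S : ℝ → X →L[ℂ] X)
    (hSc : ∀ x : X, ContinuousOn (fun t => S t x) (Set.Ioi (0:ℝ)))
    (hB : ∀ u : ℝ, ∃ M : ℝ, 0 ≤ M ∧ ∀ t ∈ Ioc 0 u, ‖S t‖ ≤ M * (|a t| + 1))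
    (u : ℝ) (x : X) : ContinuousOn (hDiff a S u x) (Ioo 0 u) := by
  have c1 : ContinuousOn (fun τ => convOp a S τ x) (Ioi 0) := fun τ hτ =>
    (conv_cont a hacont hai S hSc hB hτ x).continuousWithinAt
  have m1 : MapsTo (fun τ => τ) (Ioo 0 u) (Ioi 0) := fun τ hτ => hτ.1
  have m2 : MapsTo (fun τ => u - τ) (Ioo 0 u) (Ioi 0) := fun τ hτ =>
    show 0 < u - τ by linarith [hτ.2]
  have cs : ContinuousOn (fun τ => u - τ) (Ioo 0 u) := by fun_prop
  have d1 := c1.comp continuousOn_id m1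
  have d2 := c1.comp cs m2
  have j := S_jcont a hacont S hSc hB
  refine ContinuousOn.sub (ContinuousOn.sub ?_ ?_) (ContinuousOn.sub ?_ ?_)
  · exact j.comp (continuousOn_id.prodMk d2) fun τ hτ => ⟨m1 hτ, mem_univ _⟩
  · exact j.comp (cs.prodMk d1) fun τ hτ => ⟨m2 hτ, mem_univ _⟩
  · exact (hacont.comp continuousOn_id m1).smul d2
  · exact (hacont.comp cs m2).smul d1

/-- characterization of `(a,a)`-regularized resolvent families
by the symmetric functional equation
`∫₀^t∫₀^s a(t+s−r₁−r₂)S(r₁)S(r₂)x = ∫₀^t∫₀^s a(r₁)a(r₂)S(t+s−r₁−r₂)x`. -/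
theorem aa_resolvent_iff_functional_equation
    (a : ℝ → ℝ)
    (haloc : LocallyIntegrableOn a (Set.Ici (0:ℝ)))
    (haL : LaplaceTransformable a)
    (hacont : ContinuousOn a (Set.Ioi (0:ℝ)))
    (ha0 : ∃ σ > (0:ℝ), ∀ t ∈ Set.Ioo (0:ℝ) σ, a t ≠ 0)
    (S : ℝ → X →L[ℂ] X) (hS : Admissible S)
    (hlim : ∀ x : X,
      Tendsto (fun t => (a t)⁻¹ • S t x) (nhdsWithin 0 (Set.Ioi 0)) (nhds x)) :
    (∀ t s : ℝ, 0 < t → 0 < s → ∀ x : X,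
        S s (convOp a S t x) - S t (convOp a S s x)
          = a s • convOp a S t x - a t • convOp a S s x)
    ↔
    (∀ t s : ℝ, 0 < t → 0 < s → ∀ x : X,
        (∫ r₁ in (0:ℝ)..t, ∫ r₂ in (0:ℝ)..s, a (t + s - r₁ - r₂) • S r₁ (S r₂ x))
          = (∫ r₁ in (0:ℝ)..t, ∫ r₂ in (0:ℝ)..s,
              (a r₁ * a r₂) • S (t + s - r₁ - r₂) x)) := by
  obtain ⟨hSc, hcomm, -⟩ := hS
  have hB := S_bound a hacont ha0 S hSc hlim
  have hai : ∀ u, IntegrableOn a (Ioo 0 u) := fun u =>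
    (haloc.integrableOn_compact_subset (t := Icc 0 u) (fun r hr => hr.1) isCompact_Icc).mono_set
      Ioo_subset_Icc_self
  constructor
  · intro h t s ht hs x
    have h1 := (main_identity a hacont hai S hSc hcomm hB ht hs x).2
    rw [← sub_eq_zero, ← h1]
    refine intervalIntegral.integral_zero_ae (ae_of_all _ fun τ hτ => ?_)
    rw [uIoc_of_le ht.le] at hτ
    rw [hDiff, sub_eq_zero]
    exact h (t + s - τ) τ (by linarith [hτ.2]) hτ.1 x
  · intro h t s ht hs x
    have hz : ∀ τ ∈ Ioo 0 (t + s), (∫ r in (0:ℝ)..τ, hDiff a S (t + s) x r) = 0 := by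
      intro τ hτ
      have h1 := (main_identity a hacont hai S hSc hcomm hB hτ.1
        (show 0 < t + s - τ by linarith [hτ.2]) x).2
      rw [h _ _ hτ.1 (by linarith [hτ.2]) x, sub_self, add_sub_cancel] at h1
      exact h1
    have hs' : s ∈ Ioo 0 (t + s) := ⟨hs, by linarith⟩
    have hc := hDiff_cont a hacont hai S hSc hB (t + s) x
    have hi := (main_identity a hacont hai S hSc hcomm hB hs ht x).1
    rw [add_comm s t] at hi
    have hd := intervalIntegral.integral_hasDerivAt_right hi
      (hc.stronglyMeasurableAtFilter isOpen_Ioo s hs') (hc.continuousAt (isOpen_Ioo.mem_nhds hs'))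
    have hd' : HasDerivAt (fun v => ∫ r in (0:ℝ)..v, hDiff a S (t + s) x r) 0 s := by
      refine (hasDerivAt_const s (0 : X)).congr_of_eventuallyEq ?_
      filter_upwards [isOpen_Ioo.mem_nhds hs'] with τ hτ using hz τ hτ
    have := hd.unique hd'
    rw [hDiff, sub_eq_zero, add_sub_cancel_right] at this
    exact this
end
end
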